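/- arXiv:2505.01227 — 3 statements merged into one kernel-verified Lean document; each statement's English description precedes it below -/
import Mathlib

section
/- Let n≥2, 1≤d<n, θ∈ℝ^n, U⊂ℝ^d be open, f:U→ℝ^n be nonsingular and l-nondegenerate at x_0∈U, m=n−d, and α = 1/(d(2l−1)(n+1)). Then there exist an open neighbourhood B_0 of x_0, a constant C>0 depending on n, f, B_0, and t_0=t_0(B_0,n,f) such that for every t≥t_0 and every ε∈(0,1): N*_θ(B_0;ε,t) ≤ C( ε^m e^{(d+1)t} + e^{(d+1)t} (ε^{n−1/2} e^{3t/2})^{−α} ). -/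
open MeasureTheory Filter Set
open scoped ENNReal NNReal

noncomputable section

/-- The set `S_n^θ(ψ)` of `(ψ,θ)`-approximable points of `ℝ^n` (sup norm on `Fin n → ℝ`):
points `x` with `‖x - (p+θ)/q‖ ≤ ψ q / q` for infinitely many `(p,q) ∈ ℤ^n × ℕ`. -/
def SApprox (n : ℕ) (θ : Fin n → ℝ) (ψ : ℝ → ℝ) : Set (Fin n → ℝ) :=
  {x | {pq : (Fin n → ℤ) × ℕ | 0 < pq.2 ∧
    ‖(fun i => x i - ((pq.1 i : ℝ) + θ i) / (pq.2 : ℝ) : Fin n → ℝ)‖ ≤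
      ψ (pq.2 : ℝ) / (pq.2 : ℝ)}.Infinite}

/-- Iterated partial derivatives along a list of coordinate directions. -/
def listPDeriv {d n : ℕ} : List (Fin d) → ((Fin d → ℝ) → (Fin n → ℝ)) → ((Fin d → ℝ) → (Fin n → ℝ))
  | [], f => f
  | i :: is, f => fun x => fderiv ℝ (listPDeriv is f) x (Pi.single i 1)

/-- `f` is `l`-nondegenerate at `x`: `f` is `C^l` near `x` and the partial derivatives of `f`
at `x` of orders `1,…,l` span `ℝ^n`. -/
def IsLNondegenerateAt {d n : ℕ} (l : ℕ) (f : (Fin d → ℝ) → (Fin n → ℝ)) (x : Fin d → ℝ) : Prop :=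
  (∃ V ∈ nhds x, ContDiffOn ℝ l f V) ∧
  Submodule.span ℝ {v : Fin n → ℝ | ∃ β : List (Fin d),
    1 ≤ β.length ∧ β.length ≤ l ∧ v = listPDeriv β f x} = ⊤

def IsNondegenerateAt {d n : ℕ} (f : (Fin d → ℝ) → (Fin n → ℝ)) (x : Fin d → ℝ) : Prop :=
  ∃ l : ℕ, IsLNondegenerateAt l f x

/-- `f` is nondegenerate in `U`: nondegenerate at almost every point of `U`. -/
def IsNondegenerateIn {d n : ℕ} (f : (Fin d → ℝ) → (Fin n → ℝ)) (U : Set (Fin d → ℝ)) : Prop :=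
  ∀ᵐ x ∂(volume : Measure (Fin d → ℝ)), x ∈ U → IsNondegenerateAt f x

/-- `f` is nonsingular on `U`: its Jacobian has rank `d` at every point of `U`. -/
def IsNonsingularOn {d n : ℕ} (f : (Fin d → ℝ) → (Fin n → ℝ)) (U : Set (Fin d → ℝ)) : Prop :=
  ∀ x ∈ U, LinearMap.rank (fderiv ℝ f x).toLinearMap = (d : Cardinal)

/-- `η(n,d)`. -/
def etaND (n d : ℕ) : ℝ := if 1 < d then 1 / ((n : ℝ) - 1) else 3 / (2 * (n : ℝ) - 1)

/-- The set counted by `N*_θ(Δ;ε,t)`. -/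
def NstarSet {d n : ℕ} (f : (Fin d → ℝ) → Fin n → ℝ) (θ : Fin n → ℝ)
    (Δ : Set (Fin d → ℝ)) (ε t : ℝ) : Set ((Fin n → ℤ) × ℤ) :=
  {pq | Real.exp (t - 1) ≤ (pq.2 : ℝ) ∧ (pq.2 : ℝ) ≤ Real.exp t ∧
    sInf ((fun x => ‖(fun i => f x i - ((pq.1 i : ℝ) + θ i) / (pq.2 : ℝ) : Fin n → ℝ)‖) '' Δ)
      ≤ ε / Real.exp t}

/-- `N*_θ(Δ;ε,t)`. -/
def Nstar {d n : ℕ} (f : (Fin d → ℝ) → Fin n → ℝ) (θ : Fin n → ℝ)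
    (Δ : Set (Fin d → ℝ)) (ε t : ℝ) : ℕ := (NstarSet f θ Δ ε t).ncard

/-- The set counted by `N_θ(Δ;ε,t)` (with `1 ≤ q ≤ e^t`). -/
def NfullSet {d n : ℕ} (f : (Fin d → ℝ) → Fin n → ℝ) (θ : Fin n → ℝ)
    (Δ : Set (Fin d → ℝ)) (ε t : ℝ) : Set ((Fin n → ℤ) × ℤ) :=
  {pq | 1 ≤ pq.2 ∧ (pq.2 : ℝ) ≤ Real.exp t ∧
    sInf ((fun x => ‖(fun i => f x i - ((pq.1 i : ℝ) + θ i) / (pq.2 : ℝ) : Fin n → ℝ)‖) '' Δ)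
      ≤ ε / Real.exp t}

/-- `N_θ(Δ;ε,t)`. -/
def Nfull {d n : ℕ} (f : (Fin d → ℝ) → Fin n → ℝ) (θ : Fin n → ℝ)
    (Δ : Set (Fin d → ℝ)) (ε t : ℝ) : ℕ := (NfullSet f θ Δ ε t).ncard

/-- Sup norm of the gradient of a scalar function on `ℝ^d`. -/
def gradSupNorm {d : ℕ} (g : (Fin d → ℝ) → ℝ) (x : Fin d → ℝ) : ℝ :=
  ‖(fun j : Fin d => fderiv ℝ g x (Pi.single j 1) : Fin d → ℝ)‖

/-- The set `𝔖_f(δ,K,T)`. -/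
def SfrakSet {d n : ℕ} (U : Set (Fin d → ℝ)) (f : (Fin d → ℝ) → Fin n → ℝ)
    (δ K : ℝ) (T : Fin n → ℝ) : Set (Fin d → ℝ) :=
  {x | x ∈ U ∧ ∃ a₀ : ℤ, ∃ a : Fin n → ℤ, a ≠ 0 ∧
    |(a₀ : ℝ) + ∑ i, f x i * (a i : ℝ)| < δ ∧
    gradSupNorm (fun y => ∑ i, f y i * (a i : ℝ)) x < K ∧
    ∀ i, |(a i : ℝ)| < T i}

/-- First-order partial derivative `∂_i f_j` (0-based indices as naturals; junk value 0
out of range). -/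
def pd1 {d m : ℕ} (f : (Fin d → ℝ) → Fin m → ℝ) (i j : ℕ) (x : Fin d → ℝ) : ℝ :=
  if h : i < d ∧ j < m then
    fderiv ℝ (fun y => f y ⟨j, h.2⟩) x (Pi.single (⟨i, h.1⟩ : Fin d) 1)
  else 0

/-- Second-order partial derivative `∂_{i'} ∂_i f_j`. -/
def pd2 {d m : ℕ} (f : (Fin d → ℝ) → Fin m → ℝ) (i i' j : ℕ) (x : Fin d → ℝ) : ℝ :=
  if h : i' < d then fderiv ℝ (fun y => pd1 f i j y) x (Pi.single (⟨i', h⟩ : Fin d) 1) else 0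

/-- The Monge map `x ↦ (x, f(x)) : ℝ^d → ℝ^{d+m}`. -/
def fullMap (d m : ℕ) (f : (Fin d → ℝ) → Fin m → ℝ) : (Fin d → ℝ) → Fin (d + m) → ℝ :=
  fun x i => if h : (i : ℕ) < d then x ⟨(i : ℕ), h⟩
    else f x ⟨(i : ℕ) - d, by have := i.isLt; omega⟩

/-- The `i`-th Minkowski successive minimum (w.r.t. the closed unit Euclidean ball) of the
lattice `g ℤ^k`. -/
def succMin {k : ℕ} (i : ℕ) (g : Matrix (Fin k) (Fin k) ℝ) : ℝ :=
  sInf {r : ℝ | 0 ≤ r ∧ i ≤ Module.finrank ℝ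
    (Submodule.span ℝ {w : Fin k → ℝ | (∃ v : Fin k → ℤ, v ≠ 0 ∧
      w = g.mulVec (fun j => (v j : ℝ))) ∧ Real.sqrt (∑ j, w j ^ 2) ≤ r})}

/-- The unipotent matrix `u₁(x) ∈ SL_{n+1}(ℝ)`, `n = d+m`. -/
def u1Mat {d m : ℕ} (f : (Fin d → ℝ) → Fin m → ℝ) (x : Fin d → ℝ) :
    Matrix (Fin (d + m + 1)) (Fin (d + m + 1)) ℝ := fun r c =>
  if (r : ℕ) = (c : ℕ) then 1
  else if (r : ℕ) < m ∧ m ≤ (c : ℕ) ∧ (c : ℕ) < d + m then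
    - pd1 f (d + m - 1 - (c : ℕ)) (m - 1 - (r : ℕ)) x
  else if (r : ℕ) < m ∧ (c : ℕ) = d + m then
    (if h : m - 1 - (r : ℕ) < m then f x ⟨m - 1 - (r : ℕ), h⟩ else 0)
      - ∑ i : Fin d, x i * pd1 f (i : ℕ) (m - 1 - (r : ℕ)) x
  else if m ≤ (r : ℕ) ∧ (r : ℕ) < d + m ∧ (c : ℕ) = d + m then
    (if h : d + m - 1 - (r : ℕ) < d then x ⟨d + m - 1 - (r : ℕ), h⟩ else 0)
  else 0

/-- The inverse `a_{ε,t,v}⁻¹` of the diagonal matrix `a_{ε,t,v}`. -/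
def aInvMat (d m : ℕ) (ε t v : ℝ) : Matrix (Fin (d + m + 1)) (Fin (d + m + 1)) ℝ :=
  Matrix.diagonal (fun i => v * (if (i : ℕ) < m then ε⁻¹
    else if (i : ℕ) < d + m then (ε ^ m * Real.exp t) ^ ((1 : ℝ) / d)
    else (v ^ (d + m + 1) * Real.exp t)⁻¹))

/-- The set `𝔊(v,t,ε)`. -/
def Gfrak {d m : ℕ} (U : Set (Fin d → ℝ)) (f : (Fin d → ℝ) → Fin m → ℝ)
    (v t ε : ℝ) : Set (Fin d → ℝ) :=
  {x | x ∈ U ∧ v ≤ succMin 1 (aInvMat d m ε t v * u1Mat f x)}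

/-- The set `𝒩_θ(t,ε,B)`. -/
def NCal {d m : ℕ} (f : (Fin d → ℝ) → Fin m → ℝ) (θ : Fin (d + m) → ℝ)
    (t : ℕ) (ε : ℝ) (B : Set (Fin d → ℝ)) : Set (ℕ × (Fin d → ℤ) × (Fin m → ℤ)) :=
  {q | 0 < q.1 ∧
    (fun i => ((q.2.1 i : ℝ) + θ (Fin.castAdd m i)) / (q.1 : ℝ)) ∈ B ∧
    Real.exp ((t : ℝ) - 1) ≤ (q.1 : ℝ) ∧ (q.1 : ℝ) ≤ Real.exp t ∧
    ‖(fun j => (q.1 : ℝ) * f (fun i => ((q.2.1 i : ℝ) + θ (Fin.castAdd m i)) / (q.1 : ℝ)) j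
        - θ (Fin.natAdd d j) - (q.2.2 j : ℝ) : Fin m → ℝ)‖ ≤ ε}

/-- The set `Δ_θ(t,ε,B,ρ)`. -/
def DeltaCal {d m : ℕ} (f : (Fin d → ℝ) → Fin m → ℝ) (θ : Fin (d + m) → ℝ)
    (t : ℕ) (ε : ℝ) (B : Set (Fin d → ℝ)) (ρ : ℝ) : Set (Fin d → ℝ) :=
  ⋃ q ∈ NCal f θ t ε B,
    Metric.ball (fun i => ((q.2.1 i : ℝ) + θ (Fin.castAdd m i)) / (q.1 : ℝ)) ρ

/-- `φ = (ε^n e^t)^{1/(n+1)}`, `n = d+m`. -/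
def phiC (d m : ℕ) (ε t : ℝ) : ℝ := (ε ^ (d + m) * Real.exp t) ^ ((1 : ℝ) / (d + m + 1))

/-- `h = dt/(2(n+1))`. -/
def hC (d m : ℕ) (t : ℝ) : ℝ := (d : ℝ) * t / (2 * ((d : ℝ) + m + 1))

def gMat (d m : ℕ) (ε t : ℝ) : Matrix (Fin (d + m + 1)) (Fin (d + m + 1)) ℝ :=
  Matrix.diagonal (fun i => phiC d m ε t *
    (if (i : ℕ) < d + m then ε⁻¹ else Real.exp (-t)))

def bMat (d m : ℕ) (t : ℝ) : Matrix (Fin (d + m + 1)) (Fin (d + m + 1)) ℝ :=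
  Matrix.diagonal (fun i => if (i : ℕ) < m then Real.exp (hC d m t)
    else if (i : ℕ) < d + m then Real.exp (-(((m : ℝ) + 1) * t) / (2 * ((d : ℝ) + m + 1)))
    else Real.exp (hC d m t))

def dMat (d m : ℕ) (ε : ℝ) : Matrix (Fin (d + m + 1)) (Fin (d + m + 1)) ℝ :=
  Matrix.diagonal (fun i => if (i : ℕ) < m then 1
    else if (i : ℕ) < d + m then Real.sqrt ε else 1)

/-- The raw nongeneric set `𝔐₀(ε,t)`. -/
def M0frak {d m : ℕ} (U : Set (Fin d → ℝ)) (f : (Fin d → ℝ) → Fin m → ℝ)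
    (ε t : ℝ) : Set (Fin d → ℝ) :=
  {x | x ∈ U ∧ phiC d m ε t * Real.exp (hC d m t) <
    succMin (d + m + 1) (dMat d m ε * bMat d m t * gMat d m ε t * u1Mat f x)}

/-- The nongeneric (special) set `𝔐(ε,t)`. -/
def Mfrak {d m : ℕ} (U : Set (Fin d → ℝ)) (f : (Fin d → ℝ) → Fin m → ℝ)
    (ε t : ℝ) : Set (Fin d → ℝ) :=
  (⋃ x ∈ M0frak U f ε t, Metric.ball x (Real.sqrt ε * Real.exp (-t / 2))) ∩ U

/-- The inhomogeneous Diophantine exponent `λ_n^θ(x)` of `(x,x²,…,x^n)`, as a value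
in `[0,∞]`. -/
def lambdaN (n : ℕ) (θ : Fin n → ℝ) (x : ℝ) : ℝ≥0∞ :=
  sSup {lam : ℝ≥0∞ | ∃ τ : ℝ, lam = ENNReal.ofReal τ ∧
    (fun i : Fin n => x ^ ((i : ℕ) + 1)) ∈ SApprox n θ (fun q => q ^ (-τ))}

end

theorem rp_fderiv_apply {E F : Type*} [NormedAddCommGroup E] [NormedSpace ℝ E]
    [NormedAddCommGroup F] [NormedSpace ℝ F] {l j : ℕ} {f : E → F} {y : E}
    (hf : ContDiffAt ℝ l f y) (hj : j < l) (a : Fin j → E) :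
    HasFDerivAt (fun z => iteratedFDeriv ℝ j f z a)
      ((ContinuousMultilinearMap.apply ℝ (fun _ : Fin j => E) F a).comp (fderiv ℝ (iteratedFDeriv ℝ j f) y)) y := by
  have h := (hf.differentiableAt_iteratedFDeriv (m := j) (by exact_mod_cast hj)).hasFDerivAt
  exact (ContinuousMultilinearMap.apply ℝ (fun _ : Fin j => E) F a).hasFDerivAt.comp y h

theorem rp_symm {E F : Type*} [NormedAddCommGroup E] [NormedSpace ℝ E]
    [NormedAddCommGroup F] [NormedSpace ℝ F] {l : ℕ} {f : E → F} {W : Set E} (hW : IsOpen W)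
    (hf : ∀ y ∈ W, ContDiffAt ℝ l f y) (j : ℕ) : j ≤ l → ∀ y ∈ W, ∀ σ : Equiv.Perm (Fin j),
    ∀ v : Fin j → E, iteratedFDeriv ℝ j f y (v ∘ σ) = iteratedFDeriv ℝ j f y v := by
  induction j with
  | zero => intro _ y _ σ v; congr 1; ext i; exact i.elim0
  | succ j ih =>
    intro hj y hy σ
    have hσ : σ ∈ Submonoid.closure (range fun i : Fin j => Equiv.swap i.castSucc i.succ) := by
      rw [Equiv.Perm.mclosure_swap_castSucc_succ]; trivial
    induction hσ using Submonoid.closure_induction with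
    | one => intro v; rfl
    | mul a b _ _ ha hb =>
      intro v
      have := hb (v ∘ a)
      rw [← ha v, ← this]; rfl
    | mem a ha =>
      obtain ⟨i, rfl⟩ := ha
      intro v
      rcases j with _ | j
      · exact i.elim0
      · refine Fin.cases ?_ (fun i' => ?_) i
        · -- swap 0 1
          have hg : ContDiffAt ℝ 2 (iteratedFDeriv ℝ j f) y :=
            (hf y hy).iteratedFDeriv_right (by norm_cast; omega)
          have hs : IsSymmSndFDerivAt ℝ (iteratedFDeriv ℝ j f) y :=
            hg.isSymmSndFDerivAt (by simp)
          have key : ∀ w : Fin (j+2) → E, iteratedFDeriv ℝ (j+2) f y w =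
              fderiv ℝ (fderiv ℝ (iteratedFDeriv ℝ j f)) y (w 0) (w 1) (Fin.tail (Fin.tail w)) := by
            intro w
            rw [iteratedFDeriv_succ_apply_left]
            have h1 := rp_fderiv_apply (hf y hy) (show j+1 < l by omega) (Fin.tail w)
            have h2 : HasFDerivAt (fun z => fderiv ℝ (iteratedFDeriv ℝ j f) z (w 1)) 
              ((ContinuousLinearMap.apply ℝ (E [×j]→L[ℝ] F) (w 1)).comp (fderiv ℝ (fderiv ℝ (iteratedFDeriv ℝ j f)) y)) y := by
              have hd : DifferentiableAt ℝ (fderiv ℝ (iteratedFDeriv ℝ j f)) y :=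
                (hg.fderiv_right (m := 1) (by norm_num)).differentiableAt (by norm_num)
              have h5 := hd.hasFDerivAt.clm_apply (hasFDerivAt_const (w 1) y)
              refine h5.congr_fderiv ?_
              ext1 z
              simp
            have h3 := (ContinuousMultilinearMap.apply ℝ (fun _ : Fin j => E) F (Fin.tail (Fin.tail w))).hasFDerivAt.comp y h2
            have h4 := DFunLike.congr_fun (h1.unique h3) (w 0)
            exact h4
          rw [key, key]
          have e2 : Fin.tail (Fin.tail (v ∘ Equiv.swap (Fin.castSucc 0) (Fin.succ 0))) = Fin.tail (Fin.tail v) := by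
            ext i
            simp only [Fin.tail, Function.comp]
            rw [Equiv.swap_apply_of_ne_of_ne]
            · simp [Fin.ext_iff]
            · simp [Fin.ext_iff]
          rw [e2]
          have e0 : (v ∘ Equiv.swap (Fin.castSucc 0) (Fin.succ 0)) (0 : Fin (j+2)) = v 1 := by
            simp
          have e1 : (v ∘ Equiv.swap (Fin.castSucc 0) (Fin.succ 0)) (1 : Fin (j+2)) = v 0 := by
            simp
          rw [e0, e1, hs.eq]
        · rw [iteratedFDeriv_succ_apply_left, iteratedFDeriv_succ_apply_left]
          have e0 : (v ∘ Equiv.swap i'.succ.castSucc i'.succ.succ) 0 = v 0 := by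
            simp only [Function.comp]
            rw [Equiv.swap_apply_of_ne_of_ne]
            · simp [Fin.ext_iff]
            · simp [Fin.ext_iff]
          have e1 : Fin.tail (v ∘ Equiv.swap i'.succ.castSucc i'.succ.succ) =
              Fin.tail v ∘ Equiv.swap i'.castSucc i'.succ := by
            ext k
            simp only [Fin.tail, Function.comp]
            congr 1
            simp only [Equiv.swap_apply_def, Fin.ext_iff, Fin.val_succ, Fin.val_castSucc]
            split_ifs <;> simp_all
          rw [e0, e1]
          have h1 := rp_fderiv_apply (hf y hy) (show j+1 < l by omega) (Fin.tail v)
          have h2 := rp_fderiv_apply (hf y hy) (show j+1 < l by omega) (Fin.tail v ∘ Equiv.swap i'.castSucc i'.succ)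
          have hev : (fun z => iteratedFDeriv ℝ (j+1) f z (Fin.tail v ∘ Equiv.swap i'.castSucc i'.succ)) =ᶠ[nhds y]
              (fun z => iteratedFDeriv ℝ (j+1) f z (Fin.tail v)) := by
            filter_upwards [hW.mem_nhds hy] with z hz
            exact ih (by omega) z hz _ _
          have := (h1.congr_of_eventuallyEq hev).unique h2
          have := DFunLike.congr_fun this (v 0)
          exact this.symm

theorem rp_list {d n l : ℕ} {f : (Fin d → ℝ) → (Fin n → ℝ)} {W : Set (Fin d → ℝ)} (hW : IsOpen W)
    (hf : ∀ y ∈ W, ContDiffAt ℝ l f y) (β : List (Fin d)) : β.length ≤ l → ∀ y ∈ W,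
    listPDeriv β f y = iteratedFDeriv ℝ β.length f y (fun i => Pi.single (β.get i) 1) := by
  induction β with
  | nil => intro _ y _; simp [listPDeriv]
  | cons i β ih =>
    intro hl y hy
    simp only [List.length_cons] at hl
    have hev : listPDeriv β f =ᶠ[nhds y] fun z => iteratedFDeriv ℝ β.length f z (fun i => Pi.single (β.get i) 1) := by
      filter_upwards [hW.mem_nhds hy] with z hz
      exact ih (by omega) z hz
    have h1 := rp_fderiv_apply (hf y hy) (show β.length < l by omega) (fun i => (Pi.single (β.get i) 1 : Fin d → ℝ))
    change fderiv ℝ (listPDeriv β f) y (Pi.single i 1) = _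
    rw [hev.fderiv_eq, h1.fderiv]
    simp only [List.length_cons]
    rw [iteratedFDeriv_succ_apply_left]
    rfl

theorem rp_polar {E : Type*} [NormedAddCommGroup E] [NormedSpace ℝ E] {j : ℕ}
    (T : E [×j]→L[ℝ] ℝ) (hs : ∀ (σ : Equiv.Perm (Fin j)) v, T (v ∘ σ) = T v)
    (h0 : ∀ v, T (fun _ => v) = 0) (v : Fin j → E) : T v = 0 := by
  have h := T.iteratedFDeriv_comp_diagonal 0 v
  have e : (fun x => T (fun _ => x)) = fun _ => 0 := funext h0
  rw [e] at h
  have h2 : ∑ σ : Equiv.Perm (Fin j), T (fun i => v (σ i)) = (Nat.factorial j : ℝ) * T v := by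
    have : ∀ σ : Equiv.Perm (Fin j), T (fun i => v (σ i)) = T v := fun σ => hs σ v
    simp only [this]
    simp [Fintype.card_perm]
  rw [h2] at h
  have h3 : iteratedFDeriv ℝ j (fun _ : E => (0:ℝ)) 0 v = 0 := by
    have := iteratedFDeriv_fun_zero (𝕜 := ℝ) (E := E) (F := ℝ) (n := j)
    rw [this]; rfl
  rw [h3] at h
  have : (Nat.factorial j : ℝ) ≠ 0 := by exact_mod_cast Nat.factorial_ne_zero j
  rcases mul_eq_zero.1 h.symm with h | h
  · exact absurd h this
  · exact h

theorem rp_span {d n l : ℕ} {f : (Fin d → ℝ) → (Fin n → ℝ)} {W : Set (Fin d → ℝ)} (hW : IsOpen W)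
    (hf : ∀ y ∈ W, ContDiffAt ℝ l f y) (x : Fin d → ℝ) (hx : x ∈ W)
    (hsp : Submodule.span ℝ {v : Fin n → ℝ | ∃ β : List (Fin d),
    1 ≤ β.length ∧ β.length ≤ l ∧ v = listPDeriv β f x} = ⊤) :
    Submodule.span ℝ {w : Fin n → ℝ | ∃ (j : ℕ) (v : Fin d → ℝ), 1 ≤ j ∧ j ≤ l ∧
      w = iteratedFDeriv ℝ j f x (fun _ => v)} = ⊤ := by
  by_contra hne
  obtain ⟨φ, hφ, hker⟩ := Submodule.exists_le_ker_of_lt_top _ (lt_top_iff_ne_top.2 hne)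
  apply hφ
  rw [← LinearMap.ker_eq_top, eq_top_iff, ← hsp, Submodule.span_le]
  rintro _ ⟨β, h1, h2, rfl⟩
  rw [rp_list hW hf β h2 x hx]
  let φc : (Fin n → ℝ) →L[ℝ] ℝ := LinearMap.toContinuousLinearMap φ
  let T := φc.compContinuousMultilinearMap (iteratedFDeriv ℝ β.length f x)
  refine rp_polar T (fun σ v => ?_) (fun v => ?_) (fun i => Pi.single (β.get i) 1)
  · change φ _ = φ _
    exact congrArg φ (rp_symm hW hf _ h2 x hx σ v)
  · exact hker (Submodule.subset_span ⟨_, v, h1, h2, rfl⟩)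


theorem rp_chain (k : ℕ) : ∀ (G : ℕ → ℝ → ℝ) (a b δ h : ℝ), 0 < h →
    (∀ i < k, ∀ s ∈ Icc a b, HasDerivAt (G i) (G (i+1) s) s) →
    ∀ t : ℕ → ℝ, (∀ i < 2^k, t i ∈ Icc a b ∧ |G 0 (t i)| ≤ δ) →
    (∀ i, i + 1 < 2^k → t i + h ≤ t (i+1)) →
    ∃ s ∈ Icc a b, |G k s| ≤ (2/h)^k * δ := by
  induction k with
  | zero =>
    intro G a b δ h hh hG t ht hgap
    exact ⟨t 0, (ht 0 (by norm_num)).1, by simpa using (ht 0 (by norm_num)).2⟩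
  | succ k ih =>
    intro G a b δ h hh hG t ht hgap
    have key : ∀ i, i < 2^k → ∃ s ∈ Icc (t (2*i)) (t (2*i+1)), s ∈ Icc a b ∧ |G 1 s| ≤ 2/h*δ := by
      intro i hi
      have h1 : 2*i+1 < 2^(k+1) := by rw [pow_succ]; omega
      have hg := hgap (2*i) h1
      have hA := ht (2*i) (by omega)
      have hB := ht (2*i+1) h1
      have hlt : t (2*i) < t (2*i+1) := by linarith
      obtain ⟨c, hc, hce⟩ := exists_hasDerivAt_eq_slope (G 0) (G 1) hlt
        (fun s hs => (hG 0 (by omega) s ⟨hA.1.1.trans hs.1, hs.2.trans hB.1.2⟩).continuousAt.continuousWithinAt)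
        (fun s hs => hG 0 (by omega) s ⟨hA.1.1.trans hs.1.le, hs.2.le.trans hB.1.2⟩)
      refine ⟨c, ⟨hc.1.le, hc.2.le⟩, ⟨hA.1.1.trans hc.1.le, hc.2.le.trans hB.1.2⟩, ?_⟩
      rw [hce, abs_div, abs_of_pos (sub_pos.2 hlt), div_le_iff₀ (sub_pos.2 hlt)]
      have e1 : |G 0 (t (2*i+1)) - G 0 (t (2*i))| ≤ 2*δ := by
        have := abs_sub (G 0 (t (2*i+1))) (G 0 (t (2*i)))
        linarith [hA.2, hB.2]
      have hδ : 0 ≤ δ := (abs_nonneg _).trans hA.2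
      calc _ ≤ 2*δ := e1
        _ = 2/h*δ*h := by field_simp
        _ ≤ _ := by
          apply mul_le_mul_of_nonneg_left (by linarith) (by positivity)
    choose! s hs1 hs2 hs3 using key
    obtain ⟨y, hy, hy2⟩ := ih (fun i => G (i+1)) a b (2/h*δ) h hh
      (fun i hi x hx => hG (i+1) (by omega) x hx) s (fun i hi => ⟨hs2 i hi, hs3 i hi⟩) (by
        intro i hi
        have h1 := (hs1 i (by omega)).2
        have h2 := (hs1 (i+1) hi).1
        have := hgap (2*i+1) (by rw [pow_succ]; omega)
        have e : 2*i+1+1 = 2*(i+1) := by ring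
        rw [e] at this
        linarith)
    exact ⟨y, hy, by rw [pow_succ]; linarith⟩

theorem rp_spaced (N : ℕ) : ∀ (E : Set ℝ) (a b h : ℝ), E ⊆ Icc a b → 0 < h →
    N * h < volume.real E →
    ∃ t : ℕ → ℝ, (∀ i < N, t i ∈ E) ∧ (∀ i, i + 1 < N → t i + h ≤ t (i+1)) := by
  induction N with
  | zero => intro E a b h _ _ _; exact ⟨fun _ => 0, by simp, by simp⟩
  | succ N ih =>
    intro E a b h hE hh hv
    have hne : E.Nonempty := by
      by_contra hne
      rw [not_nonempty_iff_eq_empty] at hne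
      subst hne
      simp at hv
      have : (0:ℝ) ≤ (N+1)*h := by positivity
      linarith
    have hbb : BddBelow E := ⟨a, fun x hx => (hE hx).1⟩
    obtain ⟨t0, ht0, htlt⟩ := exists_lt_of_csInf_lt hne (show sInf E < sInf E + (volume.real E - (N+1:ℕ)*h) by linarith)
    have hsub : E ⊆ Icc (sInf E) (t0+h) ∪ (E ∩ Ici (t0+h)) := by
      intro x hx
      by_cases hxx : x ≤ t0 + h
      · exact Or.inl ⟨csInf_le hbb hx, hxx⟩
      · exact Or.inr ⟨hx, (not_le.1 hxx).le⟩
    have hfin : volume (Icc (sInf E) (t0+h) ∪ (E ∩ Ici (t0+h))) ≠ ∞ := by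
      apply ne_of_lt
      apply (measure_union_le _ _).trans_lt
      apply ENNReal.add_lt_top.2
      refine ⟨by simp, lt_of_le_of_lt (measure_mono (inter_subset_left.trans hE)) (by simp)⟩
    have h1 : volume.real E ≤ volume.real (Icc (sInf E) (t0+h)) + volume.real (E ∩ Ici (t0+h)) :=
      (measureReal_mono hsub hfin).trans (measureReal_union_le _ _)
    have hle : sInf E ≤ t0 := csInf_le hbb ht0
    rw [Real.volume_real_Icc_of_le (by linarith)] at h1
    push_cast at hv htlt
    obtain ⟨t, ht, htg⟩ := ih (E ∩ Ici (t0+h)) a b h (inter_subset_left.trans hE) hh (by nlinarith)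
    refine ⟨fun i => if i = 0 then t0 else t (i-1), ?_, ?_⟩
    · intro i hi
      rcases i with _ | i
      · simpa using ht0
      · simpa using (ht i (by omega)).1
    · intro i hi
      rcases i with _ | i
      · simpa using (ht 0 (by omega)).2
      · simpa using htg i (by omega)

/-- one-dimensional sublevel estimate -/
theorem rp_sublevel (k : ℕ) (G : ℕ → ℝ → ℝ) (a b δ c : ℝ) (hc : 0 < c)
    (hG : ∀ i < k, ∀ s ∈ Icc a b, HasDerivAt (G i) (G (i+1) s) s)
    (hlow : ∀ s ∈ Icc a b, c ≤ |G k s|)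
    (E : Set ℝ) (hE : E ⊆ Icc a b) (hEδ : ∀ s ∈ E, |G 0 s| ≤ δ) (hne : 0 < volume.real E) :
    c * (volume.real E)^k ≤ (4 * 2^k)^k * δ := by
  set s := volume.real E
  have hN : ((2^k : ℕ) : ℝ) * (s / (2*2^k)) < s := by
    push_cast
    have : (2:ℝ)^k * (s / (2*2^k)) = s/2 := by field_simp
    rw [this]; linarith
  obtain ⟨t, ht, hgap⟩ := rp_spaced (2^k) E a b (s/(2*2^k)) hE (by positivity) hN
  obtain ⟨y, hy, hy2⟩ := rp_chain k G a b δ (s/(2*2^k)) (by positivity) hG t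
    (fun i hi => ⟨hE (ht i hi), hEδ _ (ht i hi)⟩) hgap
  have h1 := (hlow y hy).trans hy2
  have e : (2 / (s/(2*2^k)))^k * δ = (4*2^k)^k * δ / s^k := by
    rw [show 2 / (s/(2*2^k)) = (4*2^k)/s by field_simp; norm_num, div_pow]; ring
  rw [e, le_div_iff₀ (by positivity)] at h1
  exact h1


theorem rp_dirs {d n l : ℕ} {f : (Fin d → ℝ) → (Fin n → ℝ)} {W : Set (Fin d → ℝ)} (hW : IsOpen W)
    (hf : ∀ y ∈ W, ContDiffAt ℝ l f y) (x : Fin d → ℝ) (hx : x ∈ W)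
    (hsp : Submodule.span ℝ {w : Fin n → ℝ | ∃ (j : ℕ) (v : Fin d → ℝ), 1 ≤ j ∧ j ≤ l ∧
      w = iteratedFDeriv ℝ j f x (fun _ => v)} = ⊤) :
    ∃ r > 0, Metric.ball x r ⊆ W ∧ ∃ c > 0, ∃ V > 0, ∀ k : Fin n → ℝ, k ≠ 0 →
      ∃ (j : ℕ) (v : Fin d → ℝ), 1 ≤ j ∧ j ≤ l ∧ ‖v‖ ≤ V ∧ ∀ y ∈ Metric.ball x r,
        c * ‖k‖ ≤ |∑ a, k a * iteratedFDeriv ℝ j f y (fun _ => v) a| := by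
  set S := {w : Fin n → ℝ | ∃ (j : ℕ) (v : Fin d → ℝ), 1 ≤ j ∧ j ≤ l ∧
      w = iteratedFDeriv ℝ j f x (fun _ => v)} with hS
  obtain ⟨S0, hS0, hS0sp⟩ := (Submodule.fg_span_iff_fg_span_finset_subset S).1
    (by rw [hsp]; exact Module.finite_def.1 inferInstance)
  rw [hsp] at hS0sp
  let L : (Fin n → ℝ) →ₗ[ℝ] (S0 → ℝ) :=
    LinearMap.pi (fun w => ∑ a, (w.1 a) • (LinearMap.proj a : (Fin n → ℝ) →ₗ[ℝ] ℝ))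
  have hLa : ∀ k w, L k w = ∑ a, k a * w.1 a := by
    intro k w; simp [L, mul_comm]
  have hinj : LinearMap.ker L = ⊥ := by
    rw [LinearMap.ker_eq_bot']
    intro k hk
    let φ : (Fin n → ℝ) →ₗ[ℝ] ℝ := ∑ a, (k a) • (LinearMap.proj a : (Fin n → ℝ) →ₗ[ℝ] ℝ)
    have hφ : ∀ y, φ y = ∑ a, k a * y a := by intro y; simp [φ]
    have h1 : Submodule.span ℝ (S0 : Set (Fin n → ℝ)) ≤ LinearMap.ker φ := by
      rw [Submodule.span_le]
      intro w hw
      have := congrFun hk ⟨w, hw⟩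
      rw [hLa] at this
      rw [SetLike.mem_coe, LinearMap.mem_ker, hφ]; exact this
    have h2 : k ∈ LinearMap.ker φ := h1 (by rw [← hS0sp]; trivial)
    rw [LinearMap.mem_ker, hφ] at h2
    have h3 := (Finset.sum_eq_zero_iff_of_nonneg (fun a _ => mul_self_nonneg (k a))).1 h2
    ext a
    exact mul_self_eq_zero.1 (h3 a (Finset.mem_univ a))
  obtain ⟨K, hK0, hK⟩ := L.exists_antilipschitzWith hinj
  have hK' : ∀ k, ‖k‖ ≤ K * ‖L k‖ := by
    intro k
    have := hK.le_mul_dist k 0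
    simpa using this
  have hKp : (0:ℝ) < K := by exact_mod_cast hK0
  have hmem : ∀ w : S0, ∃ (j : ℕ) (v : Fin d → ℝ), 1 ≤ j ∧ j ≤ l ∧
      w.1 = iteratedFDeriv ℝ j f x (fun _ => v) := fun w => hS0 w.2
  choose J Vv hJ1 hJl hJe using hmem
  set η : ℝ := 1/(4*K*(n+1)) with hη
  have hηp : 0 < η := by positivity
  have hev : ∀ᶠ y in nhds x, y ∈ W ∧ ∀ w : S0, dist (iteratedFDeriv ℝ (J w) f y (fun _ => Vv w)) w.1 < η := by
    refine Filter.Eventually.and (hW.eventually_mem hx) (eventually_all.2 (fun w => ?_))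
    have h1 : ContinuousAt (fun y => iteratedFDeriv ℝ (J w) f y (fun _ => Vv w)) x := by
      have h2 : ContinuousAt (iteratedFDeriv ℝ (J w) f) x := 
        ((hf x hx).iteratedFDeriv_right (m := 0) (i := J w) (by have := hJl w; simpa using this)).continuousAt
      exact ((ContinuousMultilinearMap.apply ℝ (fun _ : Fin (J w) => (Fin d → ℝ)) (Fin n → ℝ) (fun _ => Vv w)).continuous.continuousAt).comp h2
    have := Metric.continuousAt_iff'.1 h1 η hηp
    rwa [← hJe w] at this
  obtain ⟨r, hr, hball⟩ := Metric.eventually_nhds_iff_ball.1 hev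
  refine ⟨r, hr, fun y hy => (hball y hy).1, 1/(4*K), by positivity, 1 + ∑ w, ‖Vv w‖, by positivity, ?_⟩
  intro k hk
  have hkp : 0 < ‖k‖ := norm_pos_iff.2 hk
  have hw : ∃ w : S0, 1/(2*K) * ‖k‖ ≤ |L k w| := by
    by_contra hcon
    push Not at hcon
    have h1 : ‖L k‖ < 1/(2*K) * ‖k‖ := (pi_norm_lt_iff (by positivity)).2 hcon
    have h2 := hK' k
    have h3 : K * ‖L k‖ < K * (1/(2*K) * ‖k‖) := by gcongr
    have : K * (1/(2*K) * ‖k‖) = ‖k‖/2 := by field_simp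
    linarith
  obtain ⟨w, hw⟩ := hw
  refine ⟨J w, Vv w, hJ1 w, hJl w, ?_, ?_⟩
  · have := Finset.single_le_sum (f := fun w => ‖Vv w‖) (fun i _ => norm_nonneg _) (Finset.mem_univ w)
    linarith
  · intro y hy
    have hd := (hball y hy).2 w
    set z := iteratedFDeriv ℝ (J w) f y (fun _ => Vv w)
    have e : L k w = ∑ a, k a * z a - ∑ a, k a * (z a - w.1 a) := by
      rw [hLa, ← Finset.sum_sub_distrib]
      exact Finset.sum_congr rfl (fun a _ => by ring)
    have h2 : |∑ a, k a * (z a - w.1 a)| ≤ n * (‖k‖ * η) := by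
      refine (Finset.abs_sum_le_sum_abs _ _).trans ?_
      refine (Finset.sum_le_card_nsmul _ _ (‖k‖*η) ?_).trans (by simp)
      intro a _
      rw [abs_mul]
      have h3 := norm_le_pi_norm k a
      have h4 := norm_le_pi_norm (z - w.1) a
      rw [dist_eq_norm] at hd
      simp only [Real.norm_eq_abs, Pi.sub_apply] at h3 h4
      exact mul_le_mul h3 (h4.trans hd.le) (abs_nonneg _) (norm_nonneg _)
    have h5 : (n:ℝ) * (‖k‖*η) ≤ 1/(4*K)*‖k‖ := by
      rw [hη]
      have : 1/(4*K)*‖k‖ = (n+1) * (‖k‖ * (1/(4*K*(n+1)))) := by field_simp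
      rw [this]; gcongr; linarith
    have h6 : |L k w| ≤ |∑ a, k a * z a| + |∑ a, k a * (z a - w.1 a)| := by
      rw [e]; exact abs_sub _ _
    have h7 : 1/(2*(K:ℝ))*‖k‖ = 1/(4*K)*‖k‖ + 1/(4*K)*‖k‖ := by field_simp; norm_num
    linarith

theorem rp_line {d n l : ℕ} {f : (Fin d → ℝ) → (Fin n → ℝ)} {W : Set (Fin d → ℝ)}
    (hf : ∀ y ∈ W, ContDiffAt ℝ l f y) (k : Fin n → ℝ) (x v : Fin d → ℝ) (i : ℕ) (hi : i < l) (s : ℝ)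
    (hs : x + s • v ∈ W) :
    HasDerivAt (fun s : ℝ => ∑ a, k a * iteratedFDeriv ℝ i f (x + s • v) (fun _ => v) a)
      (∑ a, k a * iteratedFDeriv ℝ (i+1) f (x + s • v) (fun _ => v) a) s := by
  have h1 := rp_fderiv_apply (hf _ hs) hi (fun _ => v)
  have h2 : HasDerivAt (fun s : ℝ => x + s • v) v s := by
    simpa using ((hasDerivAt_id s).smul_const v).const_add x
  have h3 := h1.comp_hasDerivAt s h2
  have h4 := hasDerivAt_pi.1 h3
  have h5 : HasDerivAt (fun s : ℝ => ∑ a, k a * iteratedFDeriv ℝ i f (x + s • v) (fun _ => v) a) _ s :=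
    HasDerivAt.fun_sum (fun a (_ : a ∈ Finset.univ) => (h4 a).const_mul (k a))
  convert h5 using 1
  refine Finset.sum_congr rfl (fun a _ => ?_)
  rw [iteratedFDeriv_succ_apply_left]
  rfl

theorem rp_Ek {d n l : ℕ} (hl : 2 ≤ l) {f : (Fin d → ℝ) → (Fin n → ℝ)} {W : Set (Fin d → ℝ)} (hW : IsOpen W)
    (hf : ∀ y ∈ W, ContDiffAt ℝ l f y) (x₀ : Fin d → ℝ) (hx : x₀ ∈ W)
    (hsp : Submodule.span ℝ {w : Fin n → ℝ | ∃ (j : ℕ) (v : Fin d → ℝ), 1 ≤ j ∧ j ≤ l ∧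
      w = iteratedFDeriv ℝ j f x₀ (fun _ => v)} = ⊤) :
    ∃ r > 0, Metric.ball x₀ r ⊆ W ∧ ∃ C > 0, ∀ k : Fin n → ℝ, 1 ≤ ‖k‖ → ∀ δ : ℝ, 0 ≤ δ →
      volume {x | x ∈ Metric.ball x₀ (r/2) ∧ ∀ i : Fin d, |∑ a, k a * fderiv ℝ f x (Pi.single i 1) a| ≤ δ}
        ≤ ENNReal.ofReal (C * δ ^ (1/((l:ℝ)-1))) := by
  obtain ⟨r, hr, hrW, c, hc, V, hV, hdir⟩ := rp_dirs hW hf x₀ hx hsp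
  set r' : ℝ := min (1/2) (r/(4*V)) with hr'
  have hr'p : 0 < r' := by positivity
  have hr'1 : 2*r' ≤ 1 := by linarith [min_le_left (1/2) (r/(4*V))]
  have hr'2 : 2*r'*V ≤ r/2 := by
    have := min_le_right (1/2) (r/(4*V))
    calc 2*r'*V ≤ 2*(r/(4*V))*V := by gcongr
      _ = r/2 := by field_simp; norm_num
  set A : ℝ := (4*2^l)^l * (d*V+1) / c with hA
  have hAp : 0 < A := by positivity
  set BV := volume.real (Metric.ball x₀ r) with hBV
  refine ⟨r, hr, hrW, (BV + 1)/(2*r') * A^(1/((l:ℝ)-1)), by positivity, ?_⟩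
  intro k hk δ hδ
  have hl1 : (0:ℝ) < (l:ℝ) - 1 := by
    have : (2:ℝ) ≤ l := by exact_mod_cast hl
    linarith
  obtain ⟨j, v, hj1, hjl, hvV, hlow⟩ := hdir k (by rintro rfl; simp at hk; linarith)
  set E := {x | x ∈ Metric.ball x₀ (r/2) ∧ ∀ i : Fin d, |∑ a, k a * fderiv ℝ f x (Pi.single i 1) a| ≤ δ} with hE
  have hEm : MeasurableSet E := by
    apply Metric.isOpen_ball.measurableSet.inter
    have : {x | ∀ i : Fin d, |∑ a, k a * fderiv ℝ f x (Pi.single i 1) a| ≤ δ} =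
      ⋂ i : Fin d, {x | |∑ a, k a * fderiv ℝ f x (Pi.single i 1) a| ≤ δ} := by ext; simp
    change MeasurableSet {x | ∀ i : Fin d, |∑ a, k a * fderiv ℝ f x (Pi.single i 1) a| ≤ δ}
    rw [this]
    refine MeasurableSet.iInter (fun i => ?_)
    apply measurableSet_le _ measurable_const
    apply Measurable.abs
    refine Finset.measurable_sum _ (fun a _ => ?_)
    exact ((measurable_pi_apply a).comp (measurable_fderiv_apply_const ℝ f (Pi.single i 1))).const_mul _
  -- one-dim bound
  have hone : ∀ x, volume {s : ℝ | s ∈ Icc (-r') r' ∧ x + s • v ∈ E} ≤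
      (Metric.ball x₀ r).indicator (fun _ => ENNReal.ofReal ((A*δ)^(1/((l:ℝ)-1)))) x := by
    intro x
    set S := {s : ℝ | s ∈ Icc (-r') r' ∧ x + s • v ∈ E} with hSdef
    rcases S.eq_empty_or_nonempty with h0 | ⟨s1, hs1, hs1E⟩
    · rw [h0]; simp
    have hline : ∀ s ∈ Icc (-r') r', x + s • v ∈ Metric.ball x₀ r := by
      intro s hs
      have h1 : dist (x + s1 • v) x₀ < r/2 := hs1E.1
      have h2 : dist (x + s • v) (x + s1 • v) ≤ r/2 := by
        rw [dist_eq_norm, show x + s • v - (x + s1 • v) = (s - s1) • v by rw [sub_smul]; abel, norm_smul]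
        refine le_trans ?_ hr'2
        have : ‖s - s1‖ ≤ 2*r' := by
          rw [Real.norm_eq_abs, abs_le]; constructor <;> linarith [hs.1, hs.2, hs1.1, hs1.2]
        gcongr
      rw [Metric.mem_ball]
      linarith [dist_triangle (x + s • v) (x + s1 • v) x₀]
    have hxb : x ∈ Metric.ball x₀ r := by simpa using hline 0 ⟨by linarith, by linarith⟩
    rw [indicator_of_mem hxb]
    have hSsub : S ⊆ Icc (-r') r' := fun s hs => hs.1
    have hfin : volume S ≠ ∞ := ne_of_lt (lt_of_le_of_lt (measure_mono hSsub) (by simp))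
    rw [← ENNReal.ofReal_toReal hfin]
    apply ENNReal.ofReal_le_ofReal
    change volume.real S ≤ _
    rcases (measureReal_nonneg (μ := volume) (s := S)).eq_or_lt with h0 | hpos
    · rw [← h0]; positivity
    have hle1 : volume.real S ≤ 1 := by
      refine (measureReal_mono hSsub (by simp)).trans ?_
      rw [Real.volume_real_Icc_of_le (by linarith)]; linarith
    have hsub := rp_sublevel (j-1) (fun i s => ∑ a, k a * iteratedFDeriv ℝ (i+1) f (x + s • v) (fun _ => v) a)
      (-r') r' (d*V*δ) c hc
      (fun i hi s hs => rp_line hf k x v (i+1) (by omega) s (hrW (hline s hs)))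
      (fun s hs => by
        have := hlow _ (hline s hs)
        have hcc : c ≤ c * ‖k‖ := by nlinarith
        have hj' : j - 1 + 1 = j := Nat.sub_add_cancel hj1
        rw [← hj'] at this
        exact hcc.trans this) S hSsub (fun s hs => by
        have h1 := hs.2.2
        have e : ∑ a, k a * iteratedFDeriv ℝ (0+1) f (x + s • v) (fun _ => v) a =
            ∑ i, v i * ∑ a, k a * fderiv ℝ f (x + s • v) (Pi.single i 1) a := by
          have e1 : iteratedFDeriv ℝ (0+1) f (x + s • v) (fun _ => v) = fderiv ℝ f (x + s • v) v := by
            rw [iteratedFDeriv_succ_apply_left]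
            have := (rp_fderiv_apply (hf _ (hrW (hline s hs.1))) (show 0 < l by omega) (Fin.tail (fun _ : Fin (0+1) => v))).fderiv
            have e2 : (fun z => iteratedFDeriv ℝ 0 f z (Fin.tail (fun _ : Fin (0+1) => v))) = f := by
              ext1 z; simp
            rw [e2] at this
            rw [this]; rfl
          rw [e1]
          have e3 : v = ∑ i, v i • (Pi.single i 1 : Fin d → ℝ) := by
            ext b; simp [Finset.sum_apply, Pi.single_apply]
          have e4 : fderiv ℝ f (x + s • v) v = fderiv ℝ f (x + s • v) (∑ i, v i • (Pi.single i 1 : Fin d → ℝ)) :=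
            congrArg _ e3
          rw [e4, map_sum]
          simp only [map_smul, Finset.sum_apply, Pi.smul_apply, smul_eq_mul, Finset.mul_sum]
          rw [Finset.sum_comm]
          exact Finset.sum_congr rfl (fun i _ => Finset.sum_congr rfl (fun a _ => by ring))
        beta_reduce
        rw [e]
        refine (Finset.abs_sum_le_sum_abs _ _).trans ?_
        refine (Finset.sum_le_card_nsmul _ _ (V*δ) ?_).trans (by simp [mul_assoc])
        intro i _
        rw [abs_mul]
        exact mul_le_mul ((norm_le_pi_norm v i).trans hvV) (h1 i) (abs_nonneg _) hV.le) hpos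
    have h2 : (volume.real S)^(l-1) ≤ A * δ := by
      have h3 : (volume.real S)^(l-1) ≤ (volume.real S)^(j-1) :=
        pow_le_pow_of_le_one hpos.le hle1 (by omega)
      have h4 : ((4:ℝ)*2^(j-1))^(j-1) ≤ (4*2^l)^l := by
        calc ((4:ℝ)*2^(j-1))^(j-1) ≤ (4*2^l)^(j-1) := by
              gcongr
              · norm_num
              · omega
          _ ≤ _ := by
              apply pow_le_pow_right₀
              · have : (1:ℝ) ≤ 2^l := one_le_pow₀ (by norm_num)
                linarith
              · omega
      rw [hA, div_mul_eq_mul_div, le_div_iff₀ hc]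
      calc (volume.real S)^(l-1) * c ≤ (volume.real S)^(j-1) * c := by gcongr
        _ ≤ (4*2^(j-1))^(j-1) * (d*V*δ) := by linarith
        _ ≤ (4*2^l)^l * ((d*V+1)*δ) := by gcongr; linarith
        _ = _ := by ring
    have h5 : ((l-1 : ℕ) : ℝ) = (l:ℝ) - 1 := by
      rw [Nat.cast_sub (by omega)]; simp
    calc volume.real S = ((volume.real S)^(l-1))^(1/((l:ℝ)-1)) := by
          rw [← Real.rpow_natCast, h5, ← Real.rpow_mul hpos.le, mul_one_div_cancel hl1.ne', Real.rpow_one]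
      _ ≤ _ := by gcongr
  have hprod : MeasurableSet {p : ℝ × (Fin d → ℝ) | p.1 ∈ Icc (-r') r' ∧ p.2 + p.1 • v ∈ E} := by
    apply MeasurableSet.inter
    · exact measurableSet_Icc.preimage measurable_fst
    · apply hEm.preimage (f := fun p : ℝ × (Fin d → ℝ) => p.2 + p.1 • v)
      exact (by fun_prop : Continuous fun p : ℝ × (Fin d → ℝ) => p.2 + p.1 • v).measurable
  have hT : ENNReal.ofReal (2*r') * volume E ≤ volume (Metric.ball x₀ r) * ENNReal.ofReal ((A*δ)^(1/((l:ℝ)-1))) := by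
    have h1 := Measure.prod_apply (μ := (volume : Measure ℝ)) (ν := (volume : Measure (Fin d → ℝ))) hprod
    have h2 := Measure.prod_apply_symm (μ := (volume : Measure ℝ)) (ν := (volume : Measure (Fin d → ℝ))) hprod
    have h3 : ∀ s : ℝ, volume (Prod.mk s ⁻¹' {p : ℝ × (Fin d → ℝ) | p.1 ∈ Icc (-r') r' ∧ p.2 + p.1 • v ∈ E})
        = (Icc (-r') r').indicator (fun _ => volume E) s := by
      intro s
      by_cases hs : s ∈ Icc (-r') r'
      · rw [indicator_of_mem hs, ← measure_preimage_add_right volume (s • v) E]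
        congr 1; ext y
        exact ⟨fun h => h.2, fun h => ⟨hs, h⟩⟩
      · rw [indicator_of_notMem hs]
        convert measure_empty (μ := (volume : Measure (Fin d → ℝ)))
        ext y
        exact ⟨fun h => hs h.1, fun h => h.elim⟩
    simp_rw [h3] at h1
    rw [lintegral_indicator measurableSet_Icc, setLIntegral_const, Real.volume_Icc] at h1
    rw [mul_comm, show 2*r' = r' - -r' by ring, ← h1, h2]
    refine (lintegral_mono hone).trans ?_
    rw [lintegral_indicator Metric.isOpen_ball.measurableSet, setLIntegral_const, mul_comm]
  have hBfin : volume (Metric.ball x₀ r) ≠ ∞ := measure_ball_lt_top.ne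
  rw [← ENNReal.ofReal_toReal hBfin, ← ENNReal.ofReal_mul ENNReal.toReal_nonneg] at hT
  have hEfin : volume E ≠ ∞ := by
    apply ne_of_lt
    refine lt_of_le_of_lt (measure_mono (fun x hx => hx.1)) (measure_ball_lt_top (x := x₀) (r := r/2))
  rw [← ENNReal.ofReal_toReal hEfin, ← ENNReal.ofReal_mul (by positivity),
    ENNReal.ofReal_le_ofReal_iff (by positivity)] at hT
  rw [← ENNReal.ofReal_toReal hEfin]
  apply ENNReal.ofReal_le_ofReal
  rw [Real.mul_rpow hAp.le hδ] at hT
  change 2*r' * (volume E).toReal ≤ BV * _ at hT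
  rw [div_mul_eq_mul_div, div_mul_eq_mul_div, le_div_iff₀ (by positivity)]
  have : 0 ≤ A^(1/((l:ℝ)-1)) * δ^(1/((l:ℝ)-1)) := by positivity
  nlinarith


/-- additive character `e(p·ξ)` -/
noncomputable def rpE {n : ℕ} (y ξ : Fin n → ℝ) : ℂ :=
  Complex.exp (2 * Real.pi * Complex.I * ((∑ i, y i * ξ i : ℝ) : ℂ))

def rpCube (n : ℕ) : Set (Fin n → ℝ) := Set.pi univ (fun _ => Ioc (0:ℝ) 1)

theorem rpE_int (p : ℤ) : ∫ x in Ioc (0:ℝ) 1, Complex.exp (2 * Real.pi * Complex.I * ((p * x : ℝ) : ℂ))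
    = if p = 0 then 1 else 0 := by
  rw [← intervalIntegral.integral_of_le zero_le_one]
  split_ifs with h
  · simp [h]
  · have hc : (2 * Real.pi * Complex.I * p : ℂ) ≠ 0 := by
      simp [Real.pi_ne_zero, h]
    have e : ∀ x : ℝ, (2 * Real.pi * Complex.I * ((p * x : ℝ) : ℂ)) = (2 * Real.pi * Complex.I * p : ℂ) * x := by
      intro x; push_cast; ring
    simp_rw [e]
    rw [integral_exp_mul_complex hc]
    have : (2 * Real.pi * Complex.I * p : ℂ) * ((1:ℝ):ℂ) = p * (2 * Real.pi * Complex.I) := by push_cast; ring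
    rw [this, Complex.exp_int_mul_two_pi_mul_I]
    simp

theorem rpE_cube {n : ℕ} (p : Fin n → ℤ) : ∫ ξ in rpCube n, rpE (fun i => (p i : ℝ)) ξ
    = if p = 0 then 1 else 0 := by
  have e : ∀ ξ : Fin n → ℝ, rpE (fun i => (p i : ℝ)) ξ =
      ∏ i, Complex.exp (2 * Real.pi * Complex.I * (((p i : ℝ) * ξ i : ℝ) : ℂ)) := by
    intro ξ
    rw [rpE, ← Complex.exp_sum, ← Finset.mul_sum]
    push_cast; rfl
  simp_rw [e]
  rw [rpCube, volume_pi, Measure.restrict_pi_pi]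
  rw [integral_fintype_prod_eq_prod (fun i x => Complex.exp (2 * Real.pi * Complex.I * (((p i : ℝ) * x : ℝ) : ℂ)))]
  simp_rw [rpE_int]
  split_ifs with h
  · simp [h]
  · obtain ⟨i, hi⟩ := Function.ne_iff.1 h
    exact Finset.prod_eq_zero (Finset.mem_univ i) (by simpa using hi)

theorem rpE_cont {n : ℕ} (y : Fin n → ℝ) : Continuous (rpE y) := by
  unfold rpE; fun_prop

theorem rpE_sub {n : ℕ} (y z ξ : Fin n → ℝ) : rpE y ξ * (starRingEnd ℂ) (rpE z ξ) = rpE (fun i => y i - z i) ξ := by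
  unfold rpE
  rw [← Complex.exp_conj, ← Complex.exp_add]
  congr 1
  simp only [map_mul, Complex.conj_I, Complex.conj_ofReal, map_ofNat]
  simp only [sub_mul, Finset.sum_sub_distrib]
  push_cast; ring

theorem rpE_norm {n : ℕ} (y ξ : Fin n → ℝ) : ‖rpE y ξ‖ = 1 := by
  unfold rpE
  rw [show (2 * Real.pi * Complex.I * ((∑ i, y i * ξ i : ℝ) : ℂ)) = ((2*Real.pi * ∑ i, y i * ξ i : ℝ) : ℂ) * Complex.I by push_cast; ring]
  exact Complex.norm_exp_ofReal_mul_I _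

theorem rpE_periodic {n : ℕ} (p k : Fin n → ℤ) (ξ : Fin n → ℝ) :
    rpE (fun i => (p i : ℝ)) (ξ + fun i => (k i : ℝ)) = rpE (fun i => (p i : ℝ)) ξ := by
  unfold rpE
  have : (2 * Real.pi * Complex.I * ((∑ i, (p i : ℝ) * ((ξ + fun i => (k i : ℝ)) i) : ℝ) : ℂ))
    = 2 * Real.pi * Complex.I * ((∑ i, (p i : ℝ) * ξ i : ℝ) : ℂ) + ((∑ i, p i * k i : ℤ) : ℂ) * (2 * Real.pi * Complex.I) := by
    simp only [Pi.add_apply, mul_add, Finset.sum_add_distrib]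
    push_cast; ring
  rw [this, Complex.exp_add, Complex.exp_int_mul_two_pi_mul_I, mul_one]

noncomputable def rpT {n : ℕ} (P : Finset (Fin n → ℤ)) (ξ : Fin n → ℝ) : ℂ :=
  ∑ p ∈ P, rpE (fun i => (p i : ℝ)) ξ

theorem rpT_cont {n : ℕ} (P : Finset (Fin n → ℤ)) : Continuous (rpT P) := by
  unfold rpT; exact continuous_finsetSum _ (fun p _ => rpE_cont _)

theorem rpT_sq {n : ℕ} (P : Finset (Fin n → ℤ)) : ∫ ξ in rpCube n, ‖rpT P ξ‖^2 = P.card := by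
  have hvol : volume (rpCube n) ≠ ∞ := by
    rw [rpCube, volume_pi_pi]; simp
  have hint : ∀ y : Fin n → ℝ, IntegrableOn (rpE y) (rpCube n) := by
    intro y
    refine Measure.integrableOn_of_bounded (M := 1) hvol (rpE_cont y).aestronglyMeasurable ?_
    exact Eventually.of_forall (fun ξ => (rpE_norm y ξ).le)
  have h1 : ∫ ξ in rpCube n, ((‖rpT P ξ‖^2 : ℝ) : ℂ) = P.card := by
    have e : ∀ ξ, ((‖rpT P ξ‖^2 : ℝ) : ℂ) = ∑ p ∈ P, ∑ p' ∈ P, rpE (fun i => ((p - p') i : ℤ)) ξ := by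
      intro ξ
      push_cast
      rw [← Complex.mul_conj', rpT, map_sum, Finset.sum_mul_sum]
      refine Finset.sum_congr rfl (fun p _ => Finset.sum_congr rfl (fun p' _ => ?_))
      rw [rpE_sub]; simp
    simp_rw [e]
    rw [integral_finsetSum _ (fun p _ => integrable_finsetSum _ (fun p' _ => hint _))]
    simp_rw [integral_finsetSum P (fun p' _ => hint _), rpE_cube, sub_eq_zero]
    simp
  have h2 := (integral_ofReal (𝕜 := ℂ) (μ := volume.restrict (rpCube n)) (f := fun ξ => ‖rpT P ξ‖^2)).symm.trans h1
  apply Complex.ofReal_injective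
  rw [Complex.ofReal_natCast]
  exact h2

theorem rp_fourier {n : ℕ} (P : Finset (Fin n → ℤ)) (z : Fin n → ℝ) (K : Set (Fin n → ℝ))
    (hK : MeasurableSet K) (M : ℕ)
    (hP : ∀ p ∈ P, ∀ ξ ∈ K, |∑ i, ((p i : ℝ) - z i) * ξ i| ≤ 1/6)
    (hM : ∀ (ξ : Fin n → ℝ) (S : Finset (Fin n → ℤ)), (∀ k ∈ S, (ξ + fun i => (k i : ℝ)) ∈ K) → S.card ≤ M) :
    (P.card : ℝ≥0∞) * volume K ≤ 4 * M := by
  set F : (Fin n → ℝ) → ℝ≥0∞ := fun ξ => ENNReal.ofReal (‖rpT P ξ‖^2) with hF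
  have hFm : Measurable F := by
    apply ENNReal.measurable_ofReal.comp
    exact ((rpT_cont P).norm.pow 2).measurable
  have hvol : volume (rpCube n) ≠ ∞ := by
    rw [rpCube, volume_pi_pi]; simp
  have hcm : MeasurableSet (rpCube n) := MeasurableSet.univ_pi (fun _ => measurableSet_Ioc)
  have hsq : ∫⁻ ξ in rpCube n, F ξ = P.card := by
    rw [hF, ← ofReal_integral_eq_lintegral_ofReal, rpT_sq]
    · simp
    · refine Measure.integrableOn_of_bounded (M := (P.card:ℝ)^2) hvol ((rpT_cont P).norm.pow 2).aestronglyMeasurable ?_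
      refine Eventually.of_forall (fun ξ => ?_)
      rw [Real.norm_of_nonneg (by positivity)]
      gcongr
      refine (norm_sum_le _ _).trans ?_
      simp [rpE_norm]
    · exact Eventually.of_forall (fun ξ => by positivity)
  -- lower bound
  have hlow : ∀ ξ ∈ K, ENNReal.ofReal ((P.card:ℝ)^2/4) ≤ F ξ := by
    intro ξ hξ
    apply ENNReal.ofReal_le_ofReal
    have h1 : ‖rpT P ξ‖ = ‖rpT P ξ * (starRingEnd ℂ) (rpE z ξ)‖ := by
      rw [norm_mul, RCLike.norm_conj, rpE_norm, mul_one]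
    have h2 : (P.card:ℝ)/2 ≤ ‖rpT P ξ‖ := by
      rw [h1]
      refine le_trans ?_ (Complex.re_le_norm _)
      rw [rpT, Finset.sum_mul, Complex.re_sum]
      have : (P.card:ℝ)/2 = ∑ p ∈ P, (1/2:ℝ) := by simp; ring
      rw [this]
      apply Finset.sum_le_sum
      intro p hp
      rw [rpE_sub, rpE]
      rw [show (2 * Real.pi * Complex.I * ((∑ i, ((p i:ℝ) - z i) * ξ i : ℝ) : ℂ)) = ((2*Real.pi * ∑ i, ((p i:ℝ) - z i) * ξ i : ℝ) : ℂ) * Complex.I by push_cast; ring]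
      rw [Complex.exp_ofReal_mul_I_re, ← Real.cos_abs, ← Real.cos_pi_div_three]
      have hb := hP p hp ξ hξ
      apply Real.cos_le_cos_of_nonneg_of_le_pi (abs_nonneg _) (by linarith [Real.pi_pos])
      rw [abs_mul, abs_of_pos (by positivity)]
      nlinarith [Real.pi_pos]
    have : (P.card:ℝ)^2/4 = ((P.card:ℝ)/2)^2 := by ring
    rw [this]; gcongr
  have hup : ∫⁻ ξ in K, F ξ ≤ M * P.card := by
    have hper : ∀ (k : Fin n → ℤ) ξ, F (ξ + fun i => (k i : ℝ)) = F ξ := by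
      intro k ξ; simp only [hF, rpT, rpE_periodic]
    have hmi : ∀ k : Fin n → ℤ, MeasurableSet {ξ : Fin n → ℝ | (ξ + fun i => (k i : ℝ)) ∈ K} :=
      fun k => hK.preimage (measurable_add_const _)
    calc ∫⁻ ξ in K, F ξ = ∫⁻ ξ, K.indicator F ξ := (lintegral_indicator hK _).symm
      _ ≤ ∫⁻ ξ, ∑' k : Fin n → ℤ, (rpCube n ∩ {ξ | (ξ + fun i => (k i : ℝ)) ∈ K}).indicator F (ξ + fun i => -(k i : ℝ)) := by
        apply lintegral_mono
        intro ξ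
        by_cases h : ξ ∈ K
        · refine le_trans ?_ (ENNReal.le_tsum (fun i => ⌈ξ i⌉ - 1))
          rw [indicator_of_mem h, indicator_of_mem]
          · have := hper (fun i => ⌈ξ i⌉ - 1) (ξ + fun i => -((⌈ξ i⌉ - 1 : ℤ) : ℝ))
            rw [← this]
            apply le_of_eq; congr 1; ext i; simp; ring
          · refine ⟨fun i _ => ?_, ?_⟩
            · simp only [Pi.add_apply, mem_Ioc]
              push_cast
              have := Int.ceil_lt_add_one (ξ i)
              have := Int.le_ceil (ξ i)
              constructor <;> linarith
            · change _ ∈ K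
              convert h using 1
              ext i; simp; ring
        · rw [indicator_of_notMem h]; exact zero_le
      _ = ∑' k : Fin n → ℤ, ∫⁻ ξ, (rpCube n ∩ {ξ | (ξ + fun i => (k i : ℝ)) ∈ K}).indicator F (ξ + fun i => -(k i : ℝ)) := by
        apply lintegral_tsum
        intro k
        exact ((hFm.indicator (hcm.inter (hmi k))).comp (measurable_add_const _)).aemeasurable
      _ = ∑' k : Fin n → ℤ, ∫⁻ ξ, (rpCube n ∩ {ξ | (ξ + fun i => (k i : ℝ)) ∈ K}).indicator F ξ := by
        congr 1; ext k
        exact lintegral_add_right_eq_self (fun ξ => (rpCube n ∩ {ξ | (ξ + fun i => (k i : ℝ)) ∈ K}).indicator F ξ) _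
      _ = ∫⁻ ξ, ∑' k : Fin n → ℤ, (rpCube n ∩ {ξ | (ξ + fun i => (k i : ℝ)) ∈ K}).indicator F ξ := by
        symm; apply lintegral_tsum
        intro k
        exact (hFm.indicator (hcm.inter (hmi k))).aemeasurable
      _ ≤ ∫⁻ ξ, (rpCube n).indicator (fun ξ => M * F ξ) ξ := by
        apply lintegral_mono
        intro ξ
        beta_reduce
        rw [ENNReal.tsum_eq_iSup_sum]
        apply iSup_le
        intro S
        by_cases h : ξ ∈ rpCube n
        · rw [indicator_of_mem h]
          classical
          have : ∀ k ∈ S, (rpCube n ∩ {ξ | (ξ + fun i => (k i : ℝ)) ∈ K}).indicator F ξ =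
              if (ξ + fun i => (k i : ℝ)) ∈ K then F ξ else 0 := by
            intro k _
            simp [indicator, h]
          rw [Finset.sum_congr rfl this, ← Finset.sum_filter, Finset.sum_const, nsmul_eq_mul]
          gcongr
          exact hM ξ _ (fun k hk => (Finset.mem_filter.1 hk).2)
        · rw [indicator_of_notMem h, Finset.sum_eq_zero]
          intro k _
          rw [indicator_of_notMem (fun hh => h hh.1)]
      _ = M * P.card := by
        rw [lintegral_indicator hcm, lintegral_const_mul _ hFm, hsq]
  have h3 : ENNReal.ofReal ((P.card:ℝ)^2/4) * volume K ≤ M * P.card := by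
    refine le_trans ?_ hup
    rw [← setLIntegral_const]
    exact setLIntegral_mono' hK hlow
  rcases Nat.eq_zero_or_pos P.card with h0 | h0
  · simp [h0]
  · have e : ENNReal.ofReal ((P.card:ℝ)^2/4) = P.card * P.card / 4 := by
      rw [ENNReal.ofReal_div_of_pos (by norm_num), sq, ENNReal.ofReal_mul (by positivity)]
      simp
    rw [e] at h3
    have hpos : (P.card : ℝ≥0∞) ≠ 0 := by exact_mod_cast h0.ne'
    have h4 : (P.card : ℝ≥0∞) * (P.card * volume K) ≤ P.card * (4 * M) := by
      have := mul_le_mul_right h3 4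
      calc (P.card : ℝ≥0∞) * (P.card * volume K) = 4 * (P.card * P.card / 4 * volume K) := by
            rw [← mul_assoc, ← mul_assoc, ENNReal.mul_div_cancel (by norm_num) (by norm_num)]
        _ ≤ 4 * (M * P.card) := by gcongr
        _ = _ := by ring
    exact (ENNReal.mul_le_mul_iff_right hpos (by simp)).1 h4


theorem rp_vol {n d : ℕ} (L : (Fin n → ℝ) →L[ℝ] (Fin d → ℝ)) (A R a : ℝ) (hA : 0 ≤ A) (hR : 0 < R) (ha : 0 < a)
    (hL : ∀ ξ, ‖L ξ‖ ≤ A * ‖ξ‖) :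
    ENNReal.ofReal (R^n * a^d) ≤ ENNReal.ofReal ((A*R+a)^d) * volume {ξ : Fin n → ℝ | ‖ξ‖ ≤ R ∧ ‖L ξ‖ ≤ a} := by
  set K := {ξ : Fin n → ℝ | ‖ξ‖ ≤ R ∧ ‖L ξ‖ ≤ a} with hK
  set T := {p : (Fin d → ℝ) × (Fin n → ℝ) | ‖p.2‖ ≤ R/2 ∧ ‖L p.2 - p.1‖ ≤ a/2} with hT
  have hTm : MeasurableSet T := by
    apply IsClosed.measurableSet
    apply IsClosed.inter
    · exact isClosed_le (continuous_snd.norm) continuous_const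
    · exact isClosed_le (((L.continuous.comp continuous_snd).sub continuous_fst).norm) continuous_const
  have h1 := Measure.prod_apply (μ := (volume : Measure (Fin d → ℝ))) (ν := (volume : Measure (Fin n → ℝ))) hTm
  have h2 := Measure.prod_apply_symm (μ := (volume : Measure (Fin d → ℝ))) (ν := (volume : Measure (Fin n → ℝ))) hTm
  have h3 : ∀ ξ : Fin n → ℝ, volume ((fun τ => (τ, ξ)) ⁻¹' T) =
      (Metric.closedBall (0 : Fin n → ℝ) (R/2)).indicator (fun _ => ENNReal.ofReal (a^d)) ξ := by
    intro ξ
    by_cases hs : ξ ∈ Metric.closedBall (0 : Fin n → ℝ) (R/2)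
    · rw [indicator_of_mem hs]
      have : (fun τ => (τ, ξ)) ⁻¹' T = Metric.closedBall (L ξ) (a/2) := by
        ext τ
        rw [mem_closedBall_zero_iff] at hs
        rw [Metric.mem_closedBall, dist_comm, dist_eq_norm]
        exact ⟨fun h => h.2, fun h => ⟨hs, h⟩⟩
      rw [this, Real.volume_pi_closedBall _ (by positivity)]
      simp [mul_div_cancel₀]
    · rw [indicator_of_notMem hs]
      convert measure_empty (μ := (volume : Measure (Fin d → ℝ)))
      ext y
      rw [mem_closedBall_zero_iff] at hs
      exact ⟨fun h => hs h.1, fun h => h.elim⟩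
  have h4 : ∀ τ : Fin d → ℝ, volume (Prod.mk τ ⁻¹' T) ≤
      (Metric.closedBall (0 : Fin d → ℝ) ((A*R+a)/2)).indicator (fun _ => volume K) τ := by
    intro τ
    rcases (Prod.mk τ ⁻¹' T).eq_empty_or_nonempty with h0 | ⟨ξ0, h0⟩
    · rw [h0]; simp
    have h01 : ‖ξ0‖ ≤ R/2 := h0.1
    have h02 : ‖L ξ0 - τ‖ ≤ a/2 := h0.2
    have hmem : τ ∈ Metric.closedBall (0 : Fin d → ℝ) ((A*R+a)/2) := by
      rw [mem_closedBall_zero_iff]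
      have h5 := hL ξ0
      have h6 : ‖τ‖ ≤ ‖L ξ0‖ + ‖L ξ0 - τ‖ := by
        have := norm_sub_le (L ξ0) (L ξ0 - τ)
        simpa using this
      have h7 : A * ‖ξ0‖ ≤ A * (R/2) := by gcongr
      linarith
    rw [indicator_of_mem hmem, ← measure_preimage_add_right volume ξ0 (Prod.mk τ ⁻¹' T)]
    apply measure_mono
    intro ξ hξ
    have h11 : ‖ξ + ξ0‖ ≤ R/2 := hξ.1
    have h12 : ‖L (ξ + ξ0) - τ‖ ≤ a/2 := hξ.2
    constructor
    · have := norm_sub_le (ξ + ξ0) ξ0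
      rw [add_sub_cancel_right] at this; linarith
    · have := norm_sub_le (L (ξ + ξ0) - τ) (L ξ0 - τ)
      rw [sub_sub_sub_cancel_right, ← map_sub, add_sub_cancel_right] at this; linarith
  simp_rw [h3] at h2
  rw [lintegral_indicator Metric.isClosed_closedBall.measurableSet, setLIntegral_const,
    Real.volume_pi_closedBall _ (by positivity), ← ENNReal.ofReal_mul (by positivity)] at h2
  have h5 : R^n * a^d = a^d * (2*(R/2))^(Fintype.card (Fin n)) := by
    rw [mul_div_cancel₀ _ (by norm_num), Fintype.card_fin]; ring
  rw [h5, ← h2, h1]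
  refine (lintegral_mono h4).trans ?_
  rw [lintegral_indicator Metric.isClosed_closedBall.measurableSet, setLIntegral_const,
    Real.volume_pi_closedBall _ (by positivity), mul_comm, mul_div_cancel₀ _ (by norm_num), Fintype.card_fin]

theorem rp_taylor {n d : ℕ} {f : (Fin d → ℝ) → (Fin n → ℝ)} {x₀ : Fin d → ℝ} (hf : ContDiffAt ℝ 2 f x₀) :
    ∃ r > 0, ∃ A > 0, ∃ C > 0, ∀ x ∈ Metric.ball x₀ r, ‖fderiv ℝ f x‖ ≤ A ∧
      ∀ w ∈ Metric.ball x₀ r, ‖f w - f x - fderiv ℝ f x (w - x)‖ ≤ C * ‖w - x‖^2 := by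
  have h1 : ContDiffAt ℝ 1 (fderiv ℝ f) x₀ := hf.fderiv_right (by norm_num)
  obtain ⟨K, s, hs, hLip⟩ := h1.exists_lipschitzOnWith
  have h2 : ∀ᶠ y in nhds x₀, DifferentiableAt ℝ f y := by
    have := (hf.of_le (show (1 : WithTop ℕ∞) ≤ 2 by norm_num)).eventually (by simp)
    filter_upwards [this] with y hy
    exact hy.differentiableAt (by simp)
  have h3 : ∀ᶠ y in nhds x₀, y ∈ s := hs
  obtain ⟨r, hr, hb⟩ := Metric.eventually_nhds_iff_ball.1 (h2.and h3)
  refine ⟨r, hr, ‖fderiv ℝ f x₀‖ + K * r + 1, by positivity, K + 1, by positivity, ?_⟩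
  intro x hx
  constructor
  · have := hLip.dist_le_mul x (hb x hx).2 x₀ (hb x₀ (Metric.mem_ball_self hr)).2
    rw [dist_eq_norm] at this
    have h4 : (K:ℝ) * dist x x₀ ≤ K * r := by
      have := Metric.mem_ball.1 hx
      gcongr
    have h5 := norm_le_norm_add_norm_sub' (fderiv ℝ f x) (fderiv ℝ f x₀)
    linarith
  · intro w hw
    have hseg : segment ℝ x w ⊆ Metric.ball x₀ r := (convex_ball x₀ r).segment_subset hx hw
    have key := (convex_segment x w).norm_image_sub_le_of_norm_hasFDerivWithin_le' (𝕜 := ℝ) (f := f)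
      (f' := fderiv ℝ f) (φ := fderiv ℝ f x) (C := K * ‖w - x‖) (x := x) (y := w)
      (fun y hy => (hb y (hseg hy)).1.hasFDerivAt.hasFDerivWithinAt)
      (fun y hy => by
        have := hLip.dist_le_mul y (hb y (hseg hy)).2 x (hb x hx).2
        rw [dist_eq_norm, dist_eq_norm] at this
        refine this.trans ?_
        gcongr
        exact norm_sub_le_of_mem_segment hy)
      (left_mem_segment ℝ x w) (right_mem_segment ℝ x w)
    refine key.trans ?_
    have : 0 ≤ ‖w - x‖^2 := by positivity
    nlinarith

theorem rp_two_le {d n l : ℕ} (hdn : d < n) (f : (Fin d → ℝ) → (Fin n → ℝ)) (x : Fin d → ℝ)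
    (h : Submodule.span ℝ {v : Fin n → ℝ | ∃ β : List (Fin d),
    1 ≤ β.length ∧ β.length ≤ l ∧ v = listPDeriv β f x} = ⊤) : 2 ≤ l := by
  by_contra hl
  have hsub : {v : Fin n → ℝ | ∃ β : List (Fin d), 1 ≤ β.length ∧ β.length ≤ l ∧ v = listPDeriv β f x} ⊆
      Set.range (fun i : Fin d => listPDeriv [i] f x) := by
    rintro v ⟨β, h1, h2, rfl⟩
    have : β.length = 1 := by omega
    obtain ⟨i, rfl⟩ := List.length_eq_one_iff.1 this
    exact ⟨i, rfl⟩
  have h1 : Submodule.span ℝ (Set.range (fun i : Fin d => listPDeriv [i] f x)) = ⊤ :=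
    top_le_iff.1 (h ▸ Submodule.span_mono hsub)
  have h2 := finrank_range_le_card (R := ℝ) (fun i : Fin d => listPDeriv [i] f x)
  rw [Set.finrank, h1, finrank_top] at h2
  simp at h2
  omega

noncomputable def rpBox (n : ℕ) (R : ℝ) : Finset (Fin n → ℤ) :=
  Fintype.piFinset (fun _ : Fin n => Finset.Icc (-⌊R⌋) ⌊R⌋)

theorem rp_mem_box {n : ℕ} {R : ℝ} {k : Fin n → ℤ} (hR : 0 ≤ R) :
    k ∈ rpBox n R ↔ ‖(fun i => (k i : ℝ) : Fin n → ℝ)‖ ≤ R := by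
  rw [rpBox, Fintype.mem_piFinset, pi_norm_le_iff_of_nonneg hR]
  refine forall_congr' (fun i => ?_)
  rw [Finset.mem_Icc, Real.norm_eq_abs, abs_le, Int.le_floor, neg_le, Int.le_floor]
  push_cast
  constructor <;> rintro ⟨h1, h2⟩ <;> constructor <;> linarith

theorem rp_card_box {n : ℕ} {R : ℝ} (hR : 0 ≤ R) : ((rpBox n R).card : ℝ) ≤ (2*R+1)^n := by
  rw [rpBox, Fintype.card_piFinset]
  simp only [Int.card_Icc, Finset.prod_const, Finset.card_univ, Fintype.card_fin]
  push_cast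
  have h0 : 0 ≤ ⌊R⌋ := Int.floor_nonneg.2 hR
  have h1 : (((⌊R⌋ + 1 - -⌊R⌋).toNat : ℕ) : ℝ) = 2*(⌊R⌋:ℝ)+1 := by
    have : (((⌊R⌋ + 1 - -⌊R⌋).toNat : ℕ) : ℤ) = 2*⌊R⌋+1 := by omega
    exact_mod_cast this
  rw [h1]
  have h2 := Int.floor_le R
  have h3 : (0:ℝ) ≤ ⌊R⌋ := by exact_mod_cast h0
  gcongr

/-- the dual map `ξ ↦ (ξ · ∂_i f(x))_i` -/
noncomputable def rpL {d n : ℕ} (D : (Fin d → ℝ) →L[ℝ] (Fin n → ℝ)) : (Fin n → ℝ) →L[ℝ] (Fin d → ℝ) :=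
  ContinuousLinearMap.pi (fun i => ∑ b, (D (Pi.single i 1) b) • (ContinuousLinearMap.proj b : (Fin n → ℝ) →L[ℝ] ℝ))

theorem rpL_apply {d n : ℕ} (D : (Fin d → ℝ) →L[ℝ] (Fin n → ℝ)) (ξ : Fin n → ℝ) (i : Fin d) :
    rpL D ξ i = ∑ b, ξ b * D (Pi.single i 1) b := by
  simp [rpL, mul_comm]

theorem rpL_norm {d n : ℕ} (D : (Fin d → ℝ) →L[ℝ] (Fin n → ℝ)) (A : ℝ) (hA : ‖D‖ ≤ A) (ξ : Fin n → ℝ) :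
    ‖rpL D ξ‖ ≤ (n * A) * ‖ξ‖ := by
  have hA0 : 0 ≤ A := (norm_nonneg _).trans hA
  rw [pi_norm_le_iff_of_nonneg (by positivity)]
  intro i
  rw [rpL_apply, Real.norm_eq_abs]
  refine (Finset.abs_sum_le_sum_abs _ _).trans ?_
  refine (Finset.sum_le_card_nsmul _ _ (A*‖ξ‖) ?_).trans (by simp [mul_assoc])
  intro b _
  rw [abs_mul, mul_comm]
  have h1 : |D (Pi.single i 1) b| ≤ A := by
    have h2 := norm_le_pi_norm (D (Pi.single i 1)) b
    have h3 := D.le_opNorm (Pi.single i 1)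
    rw [Pi.norm_single, norm_one, mul_one] at h3
    exact h2.trans (h3.trans hA)
  exact mul_le_mul h1 (norm_le_pi_norm ξ b) (abs_nonneg _) hA0

theorem rpL_dual {d n : ℕ} (D : (Fin d → ℝ) →L[ℝ] (Fin n → ℝ)) (ξ : Fin n → ℝ) (v : Fin d → ℝ) :
    ∑ b, D v b * ξ b = ∑ i, v i * rpL D ξ i := by
  have e3 : v = ∑ i, v i • (Pi.single i 1 : Fin d → ℝ) := by
    ext b; simp [Finset.sum_apply, Pi.single_apply]
  have e4 : D v = D (∑ i, v i • (Pi.single i 1 : Fin d → ℝ)) := congrArg _ e3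
  rw [e4, map_sum]
  simp only [map_smul, Finset.sum_apply, Pi.smul_apply, smul_eq_mul, Finset.mul_sum, Finset.sum_mul, rpL_apply]
  rw [Finset.sum_comm]
  exact Finset.sum_congr rfl (fun i _ => Finset.sum_congr rfl (fun a _ => by ring))

open Classical in
theorem rp_point {d n : ℕ} (hd : 1 ≤ d) (hn : 1 ≤ n) (D : (Fin d → ℝ) →L[ℝ] (Fin n → ℝ)) (A C₂ ε Q ρ R a q : ℝ)
    (hA : ‖D‖ ≤ A) (hC₂ : 0 ≤ C₂) (hε : 0 < ε) (hρ : 0 < ρ) (hQ : 0 < Q)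
    (hρε : Q * ρ^2 = ε) (hq0 : 0 ≤ q) (hqQ : q ≤ Q)
    (hR : R = 1/(12*n*(C₂+2)*ε)) (ha : a = 1/(12*d*(Q*ρ)))
    (f : (Fin d → ℝ) → (Fin n → ℝ)) (θ : Fin n → ℝ) (x : Fin d → ℝ) (P : Finset (Fin n → ℤ))
    (hP : ∀ p ∈ P, ∃ w, ‖w - x‖ ≤ ρ ∧ ‖(fun i => (p i:ℝ) + θ i - q * f w i : Fin n → ℝ)‖ ≤ 2*ε ∧
      ‖f w - f x - D (w - x)‖ ≤ C₂ * ‖w - x‖^2) :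
    (P.card : ℝ) * (R^n * a^d) ≤ (n*A*R+a)^d * 4 *
      (((rpBox n (2*R)).filter (fun k => ‖rpL D (fun i => (k i:ℝ))‖ ≤ 2*a)).card : ℝ) := by
  have hdp : (0:ℝ) < d := by exact_mod_cast hd
  have hnp : (0:ℝ) < n := by exact_mod_cast hn
  have hRp : 0 < R := by rw [hR]; positivity
  have hap : 0 < a := by rw [ha]; positivity
  have hA0 : 0 ≤ A := (norm_nonneg _).trans hA
  set K := {ξ : Fin n → ℝ | ‖ξ‖ ≤ R ∧ ‖rpL D ξ‖ ≤ a} with hK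
  have hKm : MeasurableSet K := by
    apply IsClosed.measurableSet
    apply IsClosed.inter
    · exact isClosed_le continuous_norm continuous_const
    · exact isClosed_le ((rpL D).continuous.norm) continuous_const
  set M := ((rpBox n (2*R)).filter (fun k => ‖rpL D (fun i => (k i:ℝ))‖ ≤ 2*a)).card with hM
  have hv := rp_vol (rpL D) (n*A) R a (by positivity) hRp hap (rpL_norm D A hA)
  have hF := rp_fourier P (fun i => q * f x i - θ i) K hKm M (by
    intro p hp ξ hξ
    obtain ⟨w, hw1, hw2, hw3⟩ := hP p hp
    have e : ∑ i, ((p i:ℝ) - (q * f x i - θ i)) * ξ i =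
        ∑ i, (((p i:ℝ) + θ i - q * f w i) + q * (f w - f x - D (w-x)) i) * ξ i + q * ∑ i, (w-x) i * rpL D ξ i := by
      rw [← rpL_dual, Finset.mul_sum, ← Finset.sum_add_distrib]
      refine Finset.sum_congr rfl (fun i _ => ?_)
      simp only [Pi.sub_apply]; ring
    rw [e]
    refine (abs_add_le _ _).trans ?_
    have b1 : |∑ i, (((p i:ℝ) + θ i - q * f w i) + q * (f w - f x - D (w-x)) i) * ξ i| ≤ 1/12 := by
      refine (Finset.abs_sum_le_sum_abs _ _).trans ?_
      refine (Finset.sum_le_card_nsmul _ _ ((2*ε+C₂*ε)*R) ?_).trans ?_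
      · intro i _
        rw [abs_mul]
        have c1 := (norm_le_pi_norm (fun i => (p i:ℝ) + θ i - q * f w i : Fin n → ℝ) i).trans hw2
        have c2 := (norm_le_pi_norm (f w - f x - D (w-x)) i).trans hw3
        have c3 : q * |(f w - f x - D (w-x)) i| ≤ C₂ * ε := by
          calc q * |(f w - f x - D (w-x)) i| ≤ Q * (C₂ * ρ^2) := by
                refine mul_le_mul hqQ (c2.trans ?_) (abs_nonneg _) hQ.le
                gcongr
            _ = C₂ * ε := by rw [← hρε]; ring
        have c4 := (norm_le_pi_norm ξ i).trans hξ.1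
        refine mul_le_mul ?_ c4 (abs_nonneg _) (by positivity)
        refine (abs_add_le _ _).trans ?_
        rw [abs_mul, abs_of_nonneg hq0]
        exact add_le_add c1 c3
      · simp only [Finset.card_univ, Fintype.card_fin, nsmul_eq_mul]
        rw [hR]
        apply le_of_eq
        field_simp
        ring
    have b2 : |q * ∑ i, (w-x) i * rpL D ξ i| ≤ 1/12 := by
      rw [abs_mul, abs_of_nonneg hq0]
      have c1 : |∑ i, (w-x) i * rpL D ξ i| ≤ d * (ρ * a) := by
        refine (Finset.abs_sum_le_sum_abs _ _).trans ?_
        refine (Finset.sum_le_card_nsmul _ _ (ρ*a) ?_).trans (by simp)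
        intro i _
        rw [abs_mul]
        exact mul_le_mul ((norm_le_pi_norm _ i).trans hw1) ((norm_le_pi_norm _ i).trans hξ.2) (abs_nonneg _) hρ.le
      calc q * |∑ i, (w-x) i * rpL D ξ i| ≤ Q * (d * (ρ*a)) := mul_le_mul hqQ c1 (abs_nonneg _) hQ.le
        _ = 1/12 := by rw [ha]; field_simp
    linarith) (by
    intro ξ S hS
    rcases S.eq_empty_or_nonempty with h0 | ⟨k0, hk0⟩
    · rw [h0]; simp
    rw [hM]
    refine Finset.card_le_card_of_injOn (fun k => k - k0) ?_ (fun k _ k' _ h => sub_left_injective h)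
    intro k hk
    have h1 := hS k hk
    have h2 := hS k0 hk0
    have e : (fun i => (((k - k0) i : ℤ) : ℝ)) = (ξ + fun i => (k i:ℝ)) - (ξ + fun i => (k0 i:ℝ)) := by
      ext i; simp
    rw [Finset.mem_coe, Finset.mem_filter, rp_mem_box (by positivity), e]
    constructor
    · exact (norm_sub_le _ _).trans (by linarith [h1.1, h2.1])
    · rw [map_sub]
      exact (norm_sub_le _ _).trans (by linarith [h1.2, h2.2]))
  have hfin : volume K ≠ ∞ := by
    refine ne_of_lt (lt_of_le_of_lt (measure_mono (t := Metric.closedBall 0 R) ?_) measure_closedBall_lt_top)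
    intro ξ hξ
    rw [mem_closedBall_zero_iff]; exact hξ.1
  rw [← ENNReal.ofReal_toReal hfin, ← ENNReal.ofReal_mul (by positivity),
    ENNReal.ofReal_le_ofReal_iff (by positivity)] at hv
  have hF' : (P.card : ℝ) * (volume K).toReal ≤ 4 * M := by
    have := ENNReal.toReal_mono (by finiteness) hF
    simpa using this
  calc (P.card : ℝ) * (R^n * a^d) ≤ P.card * ((n*A*R+a)^d * (volume K).toReal) := by gcongr
    _ = (n*A*R+a)^d * (P.card * (volume K).toReal) := by ring
    _ ≤ (n*A*R+a)^d * (4 * M) := by gcongr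
    _ = _ := by ring

open Classical in
theorem rp_fiber {n : ℕ} (G : Finset ((Fin n → ℤ) × ℤ)) (Q u v : ℝ) (hQ : 0 ≤ Q) (hv : 0 ≤ v)
    (hG : ∀ pq ∈ G, (1:ℝ) ≤ pq.2 ∧ (pq.2:ℝ) ≤ Q)
    (hP : ∀ q : ℤ, 1 ≤ (q:ℝ) → (q:ℝ) ≤ Q → ∀ P : Finset (Fin n → ℤ), (∀ p ∈ P, (p, q) ∈ G) → (P.card:ℝ) * u ≤ v) :
    (G.card : ℝ) * u ≤ Q * v := by
  have h1 : G.card = ∑ q ∈ Finset.Icc (1:ℤ) ⌊Q⌋, (G.filter (fun pq => pq.2 = q)).card := by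
    apply Finset.card_eq_sum_card_fiberwise
    intro pq hpq
    have := hG pq hpq
    simp only [Finset.coe_Icc, Set.mem_Icc]
    exact ⟨by exact_mod_cast this.1, Int.le_floor.2 this.2⟩
  rw [h1]; push_cast
  rw [Finset.sum_mul]
  refine (Finset.sum_le_card_nsmul _ _ v ?_).trans ?_
  · intro q hq
    rw [Finset.mem_Icc] at hq
    have h2 : (G.filter (fun pq => pq.2 = q)).card = ((G.filter (fun pq => pq.2 = q)).image Prod.fst).card := by
      rw [Finset.card_image_of_injOn]
      intro p hp p' hp' h
      simp only [Finset.coe_filter] at hp hp'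
      exact Prod.ext h (hp.2.trans hp'.2.symm)
    rw [h2]
    apply hP q (by exact_mod_cast hq.1) (Int.le_floor.1 hq.2)
    intro p hp
    obtain ⟨pq, hpq, rfl⟩ := Finset.mem_image.1 hp
    rw [Finset.mem_filter] at hpq
    rw [← hpq.2]; exact hpq.1
  · rw [nsmul_eq_mul]
    refine mul_le_mul_of_nonneg_right ?_ hv
    rw [Int.card_Icc]
    have h0 : 0 ≤ ⌊Q⌋ := Int.floor_nonneg.2 hQ
    have : (((⌊Q⌋ + 1 - 1).toNat : ℕ) : ℤ) = ⌊Q⌋ := by omega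
    have h3 : (((⌊Q⌋ + 1 - 1).toNat : ℕ) : ℝ) = (⌊Q⌋ : ℝ) := by exact_mod_cast this
    rw [h3]; exact Int.floor_le Q

open Classical in
theorem rp_count {d n : ℕ} (hd : 1 ≤ d) (hn : 1 ≤ n) (A C₂ ε Q ρ R a EB r : ℝ)
    (hC₂ : 0 ≤ C₂) (hε : 0 < ε) (hρ : 0 < ρ) (hQ : 0 < Q) (hEB0 : 0 ≤ EB) (hA0 : 0 ≤ A)
    (hρε : Q * ρ^2 = ε) (hρr : ρ ≤ r/2)
    (hR : R = 1/(12*n*(C₂+2)*ε)) (ha : a = 1/(12*d*(Q*ρ)))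
    (f : (Fin d → ℝ) → (Fin n → ℝ)) (θ : Fin n → ℝ) (x₀ : Fin d → ℝ)
    (hT : ∀ x ∈ Metric.ball x₀ r, ‖fderiv ℝ f x‖ ≤ A ∧
      ∀ w ∈ Metric.ball x₀ r, ‖f w - f x - fderiv ℝ f x (w - x)‖ ≤ C₂ * ‖w - x‖^2)
    (hEB : ∀ k : Fin n → ℝ, 1 ≤ ‖k‖ →
      volume {x | x ∈ Metric.ball x₀ r ∧ ‖rpL (fderiv ℝ f x) k‖ ≤ 2*a} ≤ ENNReal.ofReal EB)
    (F : Finset ((Fin n → ℤ) × ℤ))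
    (hF : ∀ pq ∈ F, (1:ℝ) ≤ pq.2 ∧ (pq.2:ℝ) ≤ Q ∧ ∃ w ∈ Metric.ball x₀ (r/2),
      ‖(fun i => (pq.1 i:ℝ) + θ i - pq.2 * f w i : Fin n → ℝ)‖ ≤ 2*ε) :
    (F.card : ℝ) * ((2*ρ)^d * (R^n * a^d)) ≤
      Q * ((n*A*R+a)^d * 4) * (volume.real (Metric.ball x₀ r) + (4*R+1)^n * EB) := by
  have hdp : (0:ℝ) < d := by exact_mod_cast hd
  have hnp : (0:ℝ) < n := by exact_mod_cast hn
  have hRp : 0 < R := by rw [hR]; positivity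
  have hap : 0 < a := by rw [ha]; positivity
  have hw' : ∀ pq : (Fin n → ℤ) × ℤ, ∃ w, pq ∈ F → w ∈ Metric.ball x₀ (r/2) ∧
      ‖(fun i => (pq.1 i:ℝ) + θ i - pq.2 * f w i : Fin n → ℝ)‖ ≤ 2*ε := by
    intro pq
    by_cases h : pq ∈ F
    · obtain ⟨w, h1, h2⟩ := (hF pq h).2.2
      exact ⟨w, fun _ => ⟨h1, h2⟩⟩
    · exact ⟨0, fun h' => absurd h' h⟩
  choose w hw using hw'
  set c := (n*A*R+a)^d * 4 with hc
  have hcp : 0 ≤ c := by positivity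
  set E : (Fin n → ℤ) → Set (Fin d → ℝ) := fun k =>
    {x | x ∈ Metric.ball x₀ r ∧ ‖rpL (fderiv ℝ f x) (fun i => (k i:ℝ))‖ ≤ 2*a} with hE
  have hEm : ∀ k, MeasurableSet (E k) := by
    intro k
    apply Metric.isOpen_ball.measurableSet.inter
    have : {x | ‖rpL (fderiv ℝ f x) (fun i => (k i:ℝ))‖ ≤ 2*a} =
      ⋂ i : Fin d, {x | |∑ b, (k b:ℝ) * fderiv ℝ f x (Pi.single i 1) b| ≤ 2*a} := by
      ext x
      simp only [Set.mem_iInter]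
      change ‖rpL (fderiv ℝ f x) (fun i => (k i:ℝ))‖ ≤ 2*a ↔ ∀ i, |∑ b, (k b:ℝ) * fderiv ℝ f x (Pi.single i 1) b| ≤ 2*a
      rw [pi_norm_le_iff_of_nonneg (by positivity)]
      simp only [rpL_apply, Real.norm_eq_abs]
    change MeasurableSet {x | ‖rpL (fderiv ℝ f x) (fun i => (k i:ℝ))‖ ≤ 2*a}
    rw [this]
    refine MeasurableSet.iInter (fun i => ?_)
    apply measurableSet_le _ measurable_const
    apply Measurable.abs
    refine Finset.measurable_sum _ (fun b _ => ?_)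
    exact ((measurable_pi_apply b).comp (measurable_fderiv_apply_const ℝ f (Pi.single i 1))).const_mul _
  have hpt : ∀ x, x ∈ Metric.ball x₀ r → ((F.filter (fun pq => x ∈ Metric.ball (w pq) ρ)).card : ℝ) * (R^n*a^d) ≤
      (Q * c) * (((rpBox n (2*R)).filter (fun k => x ∈ E k)).card : ℝ) := by
    intro x hx
    rw [mul_assoc]
    apply rp_fiber _ Q _ _ hQ.le (by positivity)
    · intro pq hpq
      have := hF pq (Finset.mem_filter.1 hpq).1
      exact ⟨this.1, this.2.1⟩
    · intro q hq1 hqQ P hP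
      have := rp_point hd hn (fderiv ℝ f x) A C₂ ε Q ρ R a q (hT x hx).1 hC₂ hε hρ hQ hρε (by linarith) hqQ hR ha
        f θ x P (by
          intro p hp
          have h1 := Finset.mem_filter.1 (hP p hp)
          have h2 := hw _ h1.1
          refine ⟨w (p, q), ?_, h2.2, ?_⟩
          · have := h1.2
            rw [Metric.mem_ball, dist_comm, dist_eq_norm] at this; exact this.le
          · refine (hT x hx).2 _ (Metric.ball_subset_ball (by linarith) h2.1))
      refine this.trans (le_of_eq ?_)
      congr 3
      apply Finset.filter_congr
      intro k _
      exact ⟨fun h => ⟨hx, h⟩, fun h => h.2⟩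
  have hfun : ∀ x, ∑ pq ∈ F, (Metric.ball (w pq) ρ).indicator (fun _ => ENNReal.ofReal (R^n*a^d)) x ≤
      ∑ k ∈ rpBox n (2*R), (E k).indicator (fun _ => ENNReal.ofReal (Q*c)) x := by
    intro x
    by_cases hx : x ∈ Metric.ball x₀ r
    · simp only [Set.indicator_apply]
      rw [← Finset.sum_filter, ← Finset.sum_filter, Finset.sum_const, Finset.sum_const, nsmul_eq_mul, nsmul_eq_mul,
        ← ENNReal.ofReal_natCast, ← ENNReal.ofReal_natCast, ← ENNReal.ofReal_mul (by positivity),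
        ← ENNReal.ofReal_mul (by positivity)]
      apply ENNReal.ofReal_le_ofReal
      have := hpt x hx
      linarith
    · rw [Finset.sum_eq_zero]
      · exact zero_le
      · intro pq hpq
        apply Set.indicator_of_notMem
        intro h
        apply hx
        have h1 := (hw pq hpq).1
        rw [Metric.mem_ball] at *
        linarith [dist_triangle x (w pq) x₀]
  have hint := lintegral_mono (μ := (volume : Measure (Fin d → ℝ))) hfun
  rw [lintegral_finsetSum _ (fun pq _ => measurable_const.indicator Metric.isOpen_ball.measurableSet),
    lintegral_finsetSum _ (fun k _ => measurable_const.indicator (hEm k))] at hint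
  have hl : ∀ pq, ∫⁻ x, (Metric.ball (w pq) ρ).indicator (fun _ => ENNReal.ofReal (R^n*a^d)) x =
      ENNReal.ofReal ((2*ρ)^d * (R^n*a^d)) := by
    intro pq
    rw [lintegral_indicator Metric.isOpen_ball.measurableSet, setLIntegral_const, Real.volume_pi_ball _ hρ,
      ← ENNReal.ofReal_mul (by positivity), Fintype.card_fin, mul_comm]
  simp_rw [hl] at hint
  rw [Finset.sum_const, nsmul_eq_mul, ← ENNReal.ofReal_natCast, ← ENNReal.ofReal_mul (by positivity)] at hint
  have hr : ∀ k, ∫⁻ x, (E k).indicator (fun _ => ENNReal.ofReal (Q*c)) x = ENNReal.ofReal (Q*c) * volume (E k) := by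
    intro k
    rw [lintegral_indicator (hEm k), setLIntegral_const]
  simp_rw [hr] at hint
  rw [← Finset.mul_sum] at hint
  set V := volume.real (Metric.ball x₀ r) with hV
  have hVE : ∀ k, volume (E k) ≤ ENNReal.ofReal ((if k = 0 then V else 0) + EB) := by
    intro k
    by_cases hk : k = 0
    · rw [if_pos hk]
      calc volume (E k) ≤ volume (Metric.ball x₀ r) := measure_mono (fun x hx => hx.1)
        _ = ENNReal.ofReal V := (ENNReal.ofReal_toReal measure_ball_lt_top.ne).symm
        _ ≤ _ := ENNReal.ofReal_le_ofReal (by linarith)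
    · rw [if_neg hk, zero_add]
      apply hEB
      obtain ⟨i, hi⟩ := Function.ne_iff.1 hk
      have h1 := norm_le_pi_norm (fun i => (k i:ℝ)) i
      refine le_trans ?_ h1
      rw [Real.norm_eq_abs]
      exact_mod_cast Int.one_le_abs hi
  have hV0 : 0 ≤ V := measureReal_nonneg
  have hsum : ∑ k ∈ rpBox n (2*R), volume (E k) ≤ ENNReal.ofReal (V + (4*R+1)^n * EB) := by
    refine (Finset.sum_le_sum (fun k _ => hVE k)).trans ?_
    rw [← ENNReal.ofReal_sum_of_nonneg (fun k _ => by split_ifs <;> positivity)]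
    apply ENNReal.ofReal_le_ofReal
    rw [Finset.sum_add_distrib, Finset.sum_ite_eq', Finset.sum_const, nsmul_eq_mul]
    have h1 := rp_card_box (n := n) (R := 2*R) (by positivity)
    rw [show 2*(2*R)+1 = 4*R+1 by ring] at h1
    gcongr
    split_ifs <;> linarith
  have hfinal := hint.trans (mul_le_mul_right hsum (ENNReal.ofReal (Q*c)))
  rw [← ENNReal.ofReal_mul (by positivity), ENNReal.ofReal_le_ofReal_iff (by positivity)] at hfinal
  exact hfinal

theorem rp_alg {d m n : ℕ} (hm : d + m = n) (N ρ R a Q B V CE γ ε s c1 c2 : ℝ)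
    (hQ : 0 < Q) (hB : 0 ≤ B) (hV : 0 ≤ V) (hCE : 0 ≤ CE) (hε : 0 < ε) (hε1 : ε ≤ 1)
    (hs : ε ≤ s) (hc1 : 0 < c1) (hc2 : 0 < c2) (hR : R = c1/ε) (ha : a = c2/s) (hρ : ρ = s/Q)
    (hsm : s^(-γ) ≤ ε^n)
    (h : N * ((2*ρ)^d * (R^n * a^d)) ≤ Q * ((B*R+a)^d * 4) * (V + (4*R+1)^n * (CE * (2*a)^γ))) :
    N ≤ 4*(B*c1+c2)^d/((2*c2)^d*c1^n) * (V + (4*c1+1)^n*(CE*(2*c2)^γ)) * (ε^m * Q^(d+1)) := by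
  have hsp : 0 < s := hε.trans_le hs
  have hRp : 0 < R := by rw [hR]; positivity
  have hap : 0 < a := by rw [ha]; positivity
  have h1 : (4*R+1)^n * (CE * (2*a)^γ) ≤ (4*c1+1)^n*(CE*(2*c2)^γ) := by
    have e1 : (4*R+1)^n ≤ (4*c1+1)^n/ε^n := by
      rw [← div_pow]
      gcongr
      rw [hR, le_div_iff₀ hε]
      have : (4*(c1/ε)+1)*ε = 4*c1+ε := by field_simp
      linarith
    have e2 : (2*a)^γ = (2*c2)^γ * s^(-γ) := by
      rw [ha, show 2*(c2/s) = (2*c2)*s⁻¹ by field_simp, Real.mul_rpow (by positivity) (by positivity),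
        Real.inv_rpow hsp.le, Real.rpow_neg hsp.le]
    calc (4*R+1)^n * (CE * (2*a)^γ) ≤ (4*c1+1)^n/ε^n * (CE * ((2*c2)^γ * ε^n)) := by
          rw [e2]; gcongr
      _ = _ := by field_simp
  have h2 : (B*R+a)^d ≤ ((B*c1+c2)/ε)^d := by
    gcongr
    have : a ≤ c2/ε := by rw [ha]; gcongr
    rw [add_div, mul_div_assoc, ← hR]
    linarith
  have h3 : N * ((2*c2)^d * c1^n / (Q^d*ε^n)) ≤ Q * (((B*c1+c2)/ε)^d*4) * (V + (4*c1+1)^n*(CE*(2*c2)^γ)) := by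
    have e : (2*ρ)^d * (R^n * a^d) = (2*c2)^d * c1^n / (Q^d*ε^n) := by
      have : 2*ρ*a = 2*c2/Q := by rw [hρ, ha]; field_simp
      calc (2*ρ)^d * (R^n * a^d) = (2*ρ*a)^d * R^n := by rw [mul_pow (2*ρ) a]; ring
        _ = _ := by rw [this, hR, div_pow, div_pow]; field_simp
    rw [← e]
    refine h.trans ?_
    gcongr
  have hpos : 0 < (2*c2)^d * c1^n / (Q^d*ε^n) := by positivity
  refine le_of_mul_le_mul_right (h3.trans (le_of_eq ?_)) hpos
  rw [← hm, pow_add ε, div_pow, pow_succ Q]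
  field_simp

theorem rp_exp {d m n l : ℕ} (hn : 2 ≤ n) (hd : 1 ≤ d) (hdn : d < n) (hm : d + m = n) (hl : 2 ≤ l)
    (t ε : ℝ) (ht : 0 ≤ t) (hε : 0 < ε) (hε1 : ε < 1) :
    ∃ ε', ε ≤ ε' ∧ ε' ≤ 1 ∧ (Real.sqrt (ε' * Real.exp t))^(-(1/((l:ℝ)-1))) ≤ ε'^n ∧
      ε'^m ≤ ε^m + (ε ^ ((n : ℝ) - 1 / 2) * Real.exp (3 * t / 2)) ^
              (-(1 / ((d : ℝ) * (2 * (l : ℝ) - 1) * ((n : ℝ) + 1)))) := by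
  have hlR : (2:ℝ) ≤ l := by exact_mod_cast hl
  have hnR : (2:ℝ) ≤ n := by exact_mod_cast hn
  have hdR : (1:ℝ) ≤ d := by exact_mod_cast hd
  have hmR : (1:ℝ) ≤ m := by exact_mod_cast (show 1 ≤ m by omega)
  have hnm : (n:ℝ) = d + m := by exact_mod_cast hm.symm
  set T : ℝ := (d : ℝ) * (2 * (l : ℝ) - 1) * ((n : ℝ) + 1) with hT
  have hTp : 0 < T := by
    have : (0:ℝ) < 2*l-1 := by linarith
    positivity
  set D : ℝ := 2/3*(m*T + (n - 1/2)) with hD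
  have hDp : 0 < D := by
    have : (0:ℝ) < n - 1/2 := by linarith
    positivity
  have hDge : 2*n*((l:ℝ)-1)+1 ≤ D := by
    have e1 : (n:ℝ) - 1 ≤ m*d := by rw [hnm]; nlinarith
    have e2 : ((n:ℝ)-1)*((2*l-1)*(n+1)) ≤ m*T := by
      rw [hT, show (m:ℝ)*(d*(2*l-1)*(n+1)) = (m*d)*((2*l-1)*(n+1)) by ring]
      apply mul_le_mul_of_nonneg_right e1
      have : (0:ℝ) < 2*l-1 := by linarith
      positivity
    have e3 : 3/2*(n:ℝ) ≤ (n-1)*(n+1) := by nlinarith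
    have e4 : 3/2*(n:ℝ)*(2*l-1) ≤ (n-1)*(n+1)*(2*l-1) := mul_le_mul_of_nonneg_right e3 (by linarith)
    rw [hD]; nlinarith
  set c := 1/D with hc
  have hcp : 0 < c := by positivity
  have hcD : c * D = 1 := by rw [hc]; field_simp
  have hc1 : c*(2*n*((l:ℝ)-1)+1) ≤ 1 :=
    (mul_le_mul_of_nonneg_left hDge hcp.le).trans hcD.le
  have hstar1 : Real.exp (-(c*t)) ≤ 1 := by
    rw [Real.exp_le_one_iff]; have := mul_nonneg hcp.le ht; linarith
  refine ⟨max ε (Real.exp (-(c*t))), le_max_left _ _, max_le hε1.le hstar1, ?_, ?_⟩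
  · set ε' := max ε (Real.exp (-(c*t)))
    have h1 : Real.exp (-(c*t)) ≤ ε' := le_max_right _ _
    have hl1 : (0:ℝ) < (l:ℝ)-1 := by linarith
    have h2 : Real.exp ((1-c)*t/2) ≤ Real.sqrt (ε' * Real.exp t) := by
      apply Real.le_sqrt_of_sq_le
      rw [← Real.exp_nat_mul]
      calc Real.exp ((2:ℕ)*((1-c)*t/2)) = Real.exp (-(c*t)) * Real.exp t := by
            rw [← Real.exp_add]; congr 1; push_cast; ring
        _ ≤ _ := by gcongr
    calc (Real.sqrt (ε' * Real.exp t))^(-(1/((l:ℝ)-1))) ≤ (Real.exp ((1-c)*t/2))^(-(1/((l:ℝ)-1))) := by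
          apply Real.rpow_le_rpow_of_nonpos (Real.exp_pos _) h2
          have : 0 < 1/((l:ℝ)-1) := by positivity
          linarith
      _ = Real.exp (-((1-c)*t/(2*(l-1)))) := by
          rw [← Real.exp_mul]; congr 1; field_simp
      _ ≤ Real.exp (n * (-(c*t))) := by
          apply Real.exp_le_exp.2
          have : n*(c*t) ≤ (1-c)*t/(2*(l-1)) := by
            rw [le_div_iff₀ (by positivity)]
            nlinarith
          linarith
      _ = (Real.exp (-(c*t)))^n := by rw [Real.exp_nat_mul]
      _ ≤ _ := by gcongr
  · rcases le_total (Real.exp (-(c*t))) ε with h | h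
    · rw [max_eq_left h]
      have : 0 ≤ (ε ^ ((n : ℝ) - 1 / 2) * Real.exp (3 * t / 2)) ^ (-(1 / T)) := by positivity
      linarith
    · rw [max_eq_right h]
      have h1 : ε ^ ((n : ℝ) - 1 / 2) * Real.exp (3 * t / 2) ≤ Real.exp ((-(c*t))*(n-1/2) + 3*t/2) := by
        rw [Real.exp_add, Real.exp_mul]
        gcongr
        linarith
      have h2 : (Real.exp ((-(c*t))*(n-1/2) + 3*t/2))^(-(1/T)) ≤
          (ε ^ ((n : ℝ) - 1 / 2) * Real.exp (3 * t / 2))^(-(1/T)) := by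
        apply Real.rpow_le_rpow_of_nonpos (by positivity) h1
        have : 0 < 1/T := by positivity
        linarith
      have h3 : (Real.exp ((-(c*t))*(n-1/2) + 3*t/2))^(-(1/T)) = Real.exp (-(c*t))^m := by
        rw [← Real.exp_mul, ← Real.exp_nat_mul]
        congr 1
        have : 3/2 = c*(m*T + (n-1/2)) := by
          rw [hD] at hcD; linarith
        have e : (-(c*t))*(n-1/2) + 3*t/2 = (c*m*T)*t := by
          rw [show 3*t/2 = (3/2)*t by ring, this]; ring
        rw [e]; field_simp
      rw [← h3]
      have : 0 ≤ ε^m := by positivity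
      linarith

set_option maxHeartbeats 1000000

/-- **Upper bound for rational points near nondegenerate manifolds** (Theorem 1.5). -/
theorem upper_bound_rational_points
    {d n m l : ℕ} (hn : 2 ≤ n) (hd : 1 ≤ d) (hdn : d < n) (hm : d + m = n)
    (θ : Fin n → ℝ) (U : Set (Fin d → ℝ)) (hU : IsOpen U)
    (f : (Fin d → ℝ) → Fin n → ℝ) (x₀ : Fin d → ℝ) (hx₀ : x₀ ∈ U)
    (hns : IsNonsingularOn f U) (hnd : IsLNondegenerateAt l f x₀) :
    ∃ B₀ : Set (Fin d → ℝ), IsOpen B₀ ∧ x₀ ∈ B₀ ∧ B₀ ⊆ U ∧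
    ∃ C : ℝ, 0 < C ∧ ∃ t₀ : ℝ, ∀ t : ℝ, t₀ ≤ t → ∀ ε : ℝ, 0 < ε → ε < 1 →
      (Nstar f θ B₀ ε t : ℝ) ≤
        C * (ε ^ m * Real.exp (((d : ℝ) + 1) * t) +
          Real.exp (((d : ℝ) + 1) * t) *
            (ε ^ ((n : ℝ) - 1 / 2) * Real.exp (3 * t / 2)) ^
              (-(1 / ((d : ℝ) * (2 * (l : ℝ) - 1) * ((n : ℝ) + 1))))) := by
  obtain ⟨⟨V₀, hV₀, hCD⟩, hspan⟩ := hnd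
  have hl : 2 ≤ l := rp_two_le hdn f x₀ hspan
  have hlR : (2:ℝ) ≤ l := by exact_mod_cast hl
  set W := interior V₀ ∩ U with hWdef
  have hW : IsOpen W := isOpen_interior.inter hU
  have hxW : x₀ ∈ W := ⟨mem_interior_iff_mem_nhds.2 hV₀, hx₀⟩
  have hfW : ∀ y ∈ W, ContDiffAt ℝ l f y := fun y hy =>
    hCD.contDiffAt (mem_interior_iff_mem_nhds.1 hy.1)
  have hsp := rp_span hW hfW x₀ hxW hspan
  obtain ⟨r₁, hr₁, hr₁W, CE, hCE, hEk⟩ := rp_Ek hl hW hfW x₀ hxW hsp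
  obtain ⟨r₂, hr₂, A, hA, C₂, hC₂, hTay⟩ := rp_taylor ((hfW x₀ hxW).of_le
    (show (2 : WithTop ℕ∞) ≤ l by exact_mod_cast hl))
  set r := min (r₁/2) r₂ with hrdef
  have hr : 0 < r := by positivity
  have hdp : (0:ℝ) < d := by exact_mod_cast hd
  have hnp : (0:ℝ) < n := by exact_mod_cast (show 0 < n by omega)
  set c1 : ℝ := 1/(12*n*(C₂+2)) with hc1
  set c2 : ℝ := 1/(12*d) with hc2
  have hc1p : 0 < c1 := by positivity
  have hc2p : 0 < c2 := by positivity
  set γ : ℝ := 1/((l:ℝ)-1) with hγ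
  set VB := volume.real (Metric.ball x₀ r) with hVB
  have hVB0 : 0 ≤ VB := measureReal_nonneg
  set C : ℝ := 4*(n*A*c1+c2)^d/((2*c2)^d*c1^n) * (VB + (4*c1+1)^n*(CE*(2*c2)^γ)) with hC
  have hCp : 0 < C := by positivity
  refine ⟨Metric.ball x₀ (r/2), Metric.isOpen_ball, Metric.mem_ball_self (by positivity), ?_, C, hCp,
    max 1 (-2 * Real.log (r/2)), ?_⟩
  · intro y hy
    refine (hr₁W (Metric.ball_subset_ball ?_ hy)).2
    have := min_le_left (r₁/2) r₂
    linarith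
  intro t ht ε hε hε1
  have ht1 : 1 ≤ t := (le_max_left _ _).trans ht
  have ht2 : -2 * Real.log (r/2) ≤ t := (le_max_right _ _).trans ht
  obtain ⟨ε', hεε', hε'1, hsm, hfin⟩ := rp_exp hn hd hdn hm hl t ε (by linarith) hε hε1
  have hε'p : 0 < ε' := hε.trans_le hεε'
  set Q := Real.exp t with hQ
  have hQp : 0 < Q := Real.exp_pos _
  have hQ1 : 1 ≤ Q := Real.one_le_exp (by linarith)
  set s := Real.sqrt (ε' * Q) with hs
  have hsp : 0 < s := Real.sqrt_pos.2 (by positivity)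
  have hs2 : s^2 = ε' * Q := Real.sq_sqrt (by positivity)
  have hεs : ε' ≤ s := by
    apply Real.le_sqrt_of_sq_le
    nlinarith
  have hρr : s/Q ≤ r/2 := by
    have e1 : s ≤ Real.exp (t/2) := by
      rw [hs]
      apply Real.sqrt_le_iff.2
      refine ⟨(Real.exp_pos _).le, ?_⟩
      rw [← Real.exp_nat_mul, show ((2:ℕ):ℝ)*(t/2) = t by push_cast; ring]
      nlinarith
    have e2 : s/Q ≤ Real.exp (-(t/2)) := by
      rw [div_le_iff₀ hQp, hQ, ← Real.exp_add, show -(t/2) + t = t/2 by ring]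
      exact e1
    refine e2.trans ?_
    rw [← Real.exp_log (show 0 < r/2 by positivity)]
    apply Real.exp_le_exp.2
    linarith
  have hF : ∀ F : Finset ((Fin n → ℤ) × ℤ), (F : Set ((Fin n → ℤ) × ℤ)) ⊆ NstarSet f θ (Metric.ball x₀ (r/2)) ε t →
      (F.card : ℝ) ≤ C * (ε'^m * Q^(d+1)) := by
    intro F hFs
    have hcount := rp_count (d := d) (n := n) hd (by omega) A C₂ ε' Q (s/Q) (c1/ε') (c2/s) (CE * (2*(c2/s))^γ) r
      hC₂.le hε'p (by positivity) hQp (by positivity) hA.le (by rw [div_pow, hs2]; field_simp) hρr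
      (by rw [hc1]; field_simp) (by rw [hc2]; field_simp) f θ x₀
      (fun x hx => by
        have hsub : Metric.ball x₀ r ⊆ Metric.ball x₀ r₂ := Metric.ball_subset_ball (min_le_right _ _)
        exact ⟨(hTay x (hsub hx)).1, fun w hw => (hTay x (hsub hx)).2 w (hsub hw)⟩)
      (fun k hk => by
        refine (measure_mono ?_).trans (hEk k hk (2*(c2/s)) (by positivity))
        intro x hx
        refine ⟨Metric.ball_subset_ball (min_le_left _ _) hx.1, fun i => ?_⟩
        have := (norm_le_pi_norm _ i).trans hx.2
        rwa [rpL_apply, Real.norm_eq_abs] at this)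
      F (fun pq hpq => by
        obtain ⟨h1, h2, h3⟩ := hFs hpq
        have hq1 : (1:ℝ) ≤ pq.2 := (Real.one_le_exp (by linarith)).trans h1
        refine ⟨hq1, h2, ?_⟩
        have h4 : sInf ((fun x => ‖(fun i => f x i - ((pq.1 i : ℝ) + θ i) / (pq.2 : ℝ) : Fin n → ℝ)‖) ''
            Metric.ball x₀ (r/2)) < 2*ε/Q := by
          refine lt_of_le_of_lt h3 ?_
          gcongr
          linarith
        obtain ⟨_, ⟨w, hw, rfl⟩, h5⟩ := exists_lt_of_csInf_lt
          (Set.Nonempty.image _ ⟨x₀, Metric.mem_ball_self (by positivity)⟩) h4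
        refine ⟨w, hw, ?_⟩
        have hqp : (0:ℝ) < pq.2 := by linarith
        have e : (fun i => (pq.1 i:ℝ) + θ i - pq.2 * f w i : Fin n → ℝ) =
            (-(pq.2:ℝ)) • (fun i => f w i - ((pq.1 i : ℝ) + θ i) / (pq.2 : ℝ) : Fin n → ℝ) := by
          ext i
          simp only [Pi.smul_apply, smul_eq_mul]
          field_simp
          ring
        rw [e, norm_smul, norm_neg, Real.norm_eq_abs, abs_of_pos hqp]
        calc (pq.2:ℝ) * ‖(fun i => f w i - ((pq.1 i : ℝ) + θ i) / (pq.2 : ℝ) : Fin n → ℝ)‖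
            ≤ Q * (2*ε/Q) := mul_le_mul h2 h5.le (norm_nonneg _) hQp.le
          _ = 2*ε := by field_simp
          _ ≤ 2*ε' := by linarith)
    exact rp_alg hm (F.card : ℝ) (s/Q) (c1/ε') (c2/s) Q (n*A) VB CE γ ε' s c1 c2 hQp (by positivity) hVB0 hCE.le
      hε'p hε'1 hεs hc1p hc2p rfl rfl rfl hsm hcount
  have hN : (Nstar f θ (Metric.ball x₀ (r/2)) ε t : ℝ) ≤ C * (ε'^m * Q^(d+1)) := by
    rw [Nstar]
    by_cases hfi : (NstarSet f θ (Metric.ball x₀ (r/2)) ε t).Finite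
    · rw [Set.ncard_eq_toFinset_card _ hfi]
      exact hF _ (by simp)
    · rw [Set.Infinite.ncard hfi]
      simp only [Nat.cast_zero]
      positivity
  refine hN.trans ?_
  have hQd : Q^(d+1) = Real.exp (((d:ℝ)+1)*t) := by
    rw [hQ, ← Real.exp_nat_mul]; push_cast; rfl
  rw [← hQd]
  set X := (ε ^ ((n : ℝ) - 1 / 2) * Real.exp (3 * t / 2)) ^
              (-(1 / ((d : ℝ) * (2 * (l : ℝ) - 1) * ((n : ℝ) + 1)))) with hX
  have hQdp : 0 < Q^(d+1) := by positivity
  have : ε'^m * Q^(d+1) ≤ ε^m * Q^(d+1) + Q^(d+1) * X := by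
    calc ε'^m * Q^(d+1) ≤ (ε^m + X) * Q^(d+1) := mul_le_mul_of_nonneg_right hfin hQdp.le
      _ = _ := by ring
  exact mul_le_mul_of_nonneg_left this hCp.le
end

section
/- Let U⊂ℝ^d be open, x_0∈U, and f:U→ℝ^n be l-nondegenerate at x_0. Then there exists a constant C_1>0, independent of a, such that for every a∈ℝ^n with ‖a‖=1 there exist an integer k with 1≤k≤l and an orthogonal matrix O∈O(d) such that for every i=1,…,d, the k-th derivative at t=0 of the function t ↦ f(x_0 + t·O e_i)aᵀ has absolute value at least C_1, where e_1,…,e_d is the standard basis of ℝ^d. -/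
open MeasureTheory Filter Set
open scoped ENNReal NNReal

theorem rc_swap_symm {E F : Type*} [NormedAddCommGroup E] [NormedSpace ℝ E]
    [NormedAddCommGroup F] [NormedSpace ℝ F] (f : E → F) (k : ℕ) :
    ∀ x : E, ContDiffAt ℝ ((k + 1 : ℕ)) f x → ∀ (i : Fin k) (m : Fin (k + 1) → E),
      iteratedFDeriv ℝ (k + 1) f x (m ∘ Equiv.swap i.castSucc i.succ) =
        iteratedFDeriv ℝ (k + 1) f x m := by
  induction k with
  | zero => intro x _ i; exact i.elim0
  | succ k ih =>
    intro x hx i m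
    induction i using Fin.cases with
    | zero =>
      have hG : ContDiffAt ℝ 2 (iteratedFDeriv ℝ k f) x := by
        apply hx.iteratedFDeriv_right
        norm_cast
        omega
      have hs : IsSymmSndFDerivAt ℝ (iteratedFDeriv ℝ k f) x :=
        hG.isSymmSndFDerivAt (by simp)
      have key : ∀ m : Fin (k + 1 + 1) → E, iteratedFDeriv ℝ (k + 1 + 1) f x m =
          fderiv ℝ (fderiv ℝ (iteratedFDeriv ℝ k f)) x (m 0) (m 1)
            (Fin.tail (Fin.tail m)) := by
        intro m
        have h := congrFun (LinearIsometryEquiv.comp_fderiv' (𝕜 := ℝ)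
          (iso := (continuousMultilinearCurryLeftEquiv ℝ (fun _ : Fin (k + 1) => E) F).symm)
          (f := fderiv ℝ (iteratedFDeriv ℝ k f))) x
        exact congrArg (fun T => T (m 0) (Fin.tail m)) h
      rw [key, key]
      have h0 : (m ∘ Equiv.swap (Fin.castSucc (0 : Fin (k+1))) (Fin.succ 0)) 0 = m 1 := by
        simp
      have h1 : (m ∘ Equiv.swap (Fin.castSucc (0 : Fin (k+1))) (Fin.succ 0)) 1 = m 0 := by
        simp
      have h2 : Fin.tail (Fin.tail (m ∘ Equiv.swap (Fin.castSucc (0 : Fin (k+1))) (Fin.succ 0)))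
          = Fin.tail (Fin.tail m) := by
        funext j
        simp only [Fin.tail, Function.comp]
        rw [Equiv.swap_apply_of_ne_of_ne]
        · simp [Fin.ext_iff]
        · simp [Fin.ext_iff]
      rw [h0, h1, h2, hs.eq]
    | succ j =>
      have hd : DifferentiableAt ℝ (iteratedFDeriv ℝ (k + 1) f) x :=
        hx.differentiableAt_iteratedFDeriv (by norm_cast; omega)
      rw [hd.iteratedFDeriv_succ_apply_left', hd.iteratedFDeriv_succ_apply_left']
      have h0 : (m ∘ Equiv.swap (Fin.castSucc j.succ) (Fin.succ j.succ)) 0 = m 0 := by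
        simp only [Function.comp]
        rw [Equiv.swap_apply_of_ne_of_ne]
        · simp [Fin.ext_iff]
        · simp [Fin.ext_iff]
      have h1 : Fin.tail (m ∘ Equiv.swap (Fin.castSucc j.succ) (Fin.succ j.succ)) =
          Fin.tail m ∘ Equiv.swap j.castSucc j.succ := by
        funext i
        simp only [Fin.tail, Function.comp]
        congr 1
        rw [← Fin.succ_castSucc]
        simp only [Equiv.swap_apply_def, Fin.succ_inj]
        split_ifs <;> rfl
      rw [h0, h1]
      have he : (fun y => iteratedFDeriv ℝ (k + 1) f y (Fin.tail m ∘ Equiv.swap j.castSucc j.succ))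
          =ᶠ[nhds x] fun y => iteratedFDeriv ℝ (k + 1) f y (Fin.tail m) := by
        have h3 : ContDiffAt ℝ ((k + 1 : ℕ)) f x := hx.of_le (by norm_cast; omega)
        filter_upwards [h3.eventually (by simp)] with y hy
        exact ih y hy j (Fin.tail m)
      rw [he.fderiv_eq]

theorem rc_perm_symm {E F : Type*} [NormedAddCommGroup E] [NormedSpace ℝ E]
    [NormedAddCommGroup F] [NormedSpace ℝ F] (f : E → F) (k : ℕ)
    (x : E) (hx : ContDiffAt ℝ (k : ℕ) f x) (σ : Equiv.Perm (Fin k)) (m : Fin k → E) :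
      iteratedFDeriv ℝ k f x (m ∘ σ) = iteratedFDeriv ℝ k f x m := by
  cases k with
  | zero => congr 1; funext i; exact i.elim0
  | succ k =>
    have h : σ ∈ Submonoid.closure
        (Set.range fun i : Fin k ↦ Equiv.swap i.castSucc i.succ) := by
      rw [Equiv.Perm.mclosure_swap_castSucc_succ]; trivial
    induction h using Submonoid.closure_induction generalizing m with
    | mem s hs =>
      obtain ⟨i, rfl⟩ := hs
      exact rc_swap_symm f k x hx i m
    | one => rfl
    | mul s t _ _ h1 h2 =>
      have : m ∘ (s * t : Equiv.Perm _) = (m ∘ s) ∘ t := rfl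
      rw [this, h2, h1]

theorem rc_polar {E : Type*} [AddCommGroup E] [Module ℝ E] {k : ℕ}
    (L : MultilinearMap ℝ (fun _ : Fin k => E) ℝ)
    (hs : ∀ (m : Fin k → E) (σ : Equiv.Perm (Fin k)), L (m ∘ σ) = L m)
    (h0 : ∀ v, L (fun _ => v) = 0) (m : Fin k → E) : L m = 0 := by
  classical
  let p : MvPolynomial (Fin k) ℝ := ∑ r : Fin k → Fin k,
    MvPolynomial.monomial (∑ j, Finsupp.single (r j) 1) (L (m ∘ r))
  have hp : p = 0 := by
    apply MvPolynomial.funext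
    intro x
    have h1 := h0 (∑ i, x i • m i)
    rw [MultilinearMap.map_sum L (fun _ i => x i • m i)] at h1
    simp only [MultilinearMap.map_smul_univ] at h1
    rw [map_zero, ← h1]
    simp only [p, map_sum, MvPolynomial.eval_monomial]
    refine Finset.sum_congr rfl fun r _ => ?_
    rw [smul_eq_mul, mul_comm]
    congr 1
    rw [← Finsupp.prod_finsetSum_index (fun i => pow_zero _) (fun i a b => pow_add _ _ _)]
    simp
  have hc := congrArg (MvPolynomial.coeff (∑ j : Fin k, Finsupp.single j 1)) hp
  simp only [p, MvPolynomial.coeff_sum, MvPolynomial.coeff_monomial,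
    MvPolynomial.coeff_zero] at hc
  have h2 : ∀ r : Fin k → Fin k,
      (if (∑ j, Finsupp.single (r j) 1 : Fin k →₀ ℕ) = ∑ j : Fin k, Finsupp.single j 1
        then L (m ∘ r) else 0) =
      (if (∑ j, Finsupp.single (r j) 1 : Fin k →₀ ℕ) = ∑ j : Fin k, Finsupp.single j 1
        then 1 else 0) * L m := by
    intro r
    split_ifs with h
    · have hsurj : Function.Surjective r := by
        intro i
        by_contra hi
        push Not at hi
        have := DFunLike.congr_fun h i
        simp [Finsupp.finsetSum_apply, Finsupp.single_apply, hi] at this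
      have hb : Function.Bijective r := Finite.surjective_iff_bijective.mp hsurj
      rw [one_mul]
      exact hs m (Equiv.ofBijective r hb)
    · simp
  rw [Finset.sum_congr rfl fun r _ => h2 r, ← Finset.sum_mul] at hc
  rcases mul_eq_zero.mp hc with h | h
  · exfalso
    have h3 := (Finset.sum_eq_zero_iff_of_nonneg (fun r _ => by split_ifs <;> simp)).mp h id
      (Finset.mem_univ _)
    simp at h3
  · exact h

theorem rc_line {E F : Type*} [NormedAddCommGroup E] [NormedSpace ℝ E]
    [NormedAddCommGroup F] [NormedSpace ℝ F] (g : E → F) (x v : E) (k : ℕ) :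
    ∀ t : ℝ, ContDiffAt ℝ (k : ℕ) g (x + t • v) →
      iteratedDeriv k (fun t : ℝ => g (x + t • v)) t =
        iteratedFDeriv ℝ k g (x + t • v) (fun _ => v) := by
  induction k with
  | zero => intro t _; simp
  | succ k ih =>
    intro t ht
    rw [iteratedDeriv_succ]
    have hc : Continuous (fun s : ℝ => x + s • v) := by fun_prop
    have h3 : ContDiffAt ℝ (k : ℕ) g (x + t • v) := ht.of_le (by norm_cast; omega)
    have he : iteratedDeriv k (fun t : ℝ => g (x + t • v)) =ᶠ[nhds t]
        fun s => iteratedFDeriv ℝ k g (x + s • v) (fun _ => v) := by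
      filter_upwards [hc.continuousAt.eventually (h3.eventually (by simp))] with s hs
      exact ih s hs
    rw [he.deriv_eq]
    have hd : DifferentiableAt ℝ (iteratedFDeriv ℝ k g) (x + t • v) :=
      ht.differentiableAt_iteratedFDeriv (by norm_cast; omega)
    rw [hd.iteratedFDeriv_succ_apply_left']
    have hd2 : DifferentiableAt ℝ (fun y => iteratedFDeriv ℝ k g y (fun _ => v)) (x + t • v) := by
      exact hd.continuousMultilinear_apply_const _
    have hl : HasDerivAt (fun s : ℝ => x + s • v) v t := by
      simpa using ((hasDerivAt_id t).smul_const v).const_add x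
    exact (hd2.hasFDerivAt.comp_hasDerivAt t hl).deriv

theorem rc_list {d n : ℕ} (f : (Fin d → ℝ) → (Fin n → ℝ)) (β : List (Fin d)) :
    ∀ x, ContDiffAt ℝ (β.length : ℕ) f x →
      listPDeriv β f x = iteratedFDeriv ℝ β.length f x (fun j => Pi.single (β.get j) 1) := by
  induction β with
  | nil => intro x _; simp [listPDeriv]
  | cons i β ih =>
    intro x hx
    rw [List.length_cons] at hx
    have h3 : ContDiffAt ℝ (β.length : ℕ) f x := hx.of_le (by norm_cast; omega)
    have hd : DifferentiableAt ℝ (iteratedFDeriv ℝ β.length f) x :=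
      hx.differentiableAt_iteratedFDeriv (by norm_cast; omega)
    have he : listPDeriv β f =ᶠ[nhds x]
        fun y => iteratedFDeriv ℝ β.length f y (fun j => Pi.single (β.get j) 1) := by
      filter_upwards [h3.eventually (by simp)] with y hy
      exact ih y hy
    simp only [listPDeriv]
    rw [he.fderiv_eq]
    exact (hd.iteratedFDeriv_succ_apply_left'
      (m := fun j : Fin (β.length + 1) => Pi.single ((i :: β).get j) 1)).symm

open scoped Matrix in
theorem rc_orth {d k : ℕ} (hk : 1 ≤ k)
    (M : MultilinearMap ℝ (fun _ : Fin k => Fin d → ℝ) ℝ) (v : Fin d → ℝ)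
    (hv : M (fun _ => v) ≠ 0) :
    ∃ O : Matrix (Fin d) (Fin d) ℝ, O ∈ Matrix.orthogonalGroup (Fin d) ℝ ∧
      ∀ i : Fin d, M (fun _ => O.mulVec (Pi.single i 1)) ≠ 0 := by
  classical
  have hsmul : ∀ (c : ℝ) (u : Fin d → ℝ), M (fun _ => c • u) = c ^ k * M (fun _ => u) := by
    intro c u
    rw [MultilinearMap.map_smul_univ M (fun _ => c) (fun _ => u)]
    simp
  let u : (Fin d → ℝ) → Fin d → Fin d → ℝ := fun w i =>
    (w ⬝ᵥ w) • Pi.single i 1 - (2 * w i) • w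
  let q : Fin d → Fin d → MvPolynomial (Fin d) ℝ := fun i m =>
    (∑ s, MvPolynomial.X s * MvPolynomial.X s) * MvPolynomial.C ((Pi.single i 1 : Fin d → ℝ) m)
      - 2 * MvPolynomial.X i * MvPolynomial.X m
  have hq : ∀ w i m, MvPolynomial.eval w (q i m) = u w i m := by
    intro w i m
    simp [q, u, dotProduct]
  let Q : Fin d → MvPolynomial (Fin d) ℝ := fun i => ∑ r : Fin k → Fin d,
    MvPolynomial.C (M (fun j => Pi.single (r j) 1)) * ∏ j, q i (r j)
  have hQ : ∀ w i, MvPolynomial.eval w (Q i) = M (fun _ => u w i) := by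
    intro w i
    have h1 : u w i = ∑ m, u w i m • (Pi.single m 1 : Fin d → ℝ) := by
      exact pi_eq_sum_univ' (u w i) |>.trans (by
        refine Finset.sum_congr rfl fun m _ => ?_
        congr 1)
    rw [h1, MultilinearMap.map_sum M (fun _ m => u w i m • (Pi.single m 1 : Fin d → ℝ))]
    simp only [MultilinearMap.map_smul_univ]
    simp only [Q, map_sum, map_mul, map_prod, MvPolynomial.eval_C, hq, smul_eq_mul]
    exact Finset.sum_congr rfl fun r _ => mul_comm _ _
  have hv0 : v ≠ 0 := by
    rintro rfl
    apply hv
    exact M.map_coord_zero ⟨0, hk⟩ rfl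
  have hvv : 0 < v ⬝ᵥ v := by
    have h := dotProduct_self_eq_zero (v := v)
    have h2 : 0 ≤ v ⬝ᵥ v := Finset.sum_nonneg fun i _ => mul_self_nonneg _
    exact lt_of_le_of_ne h2 fun h3 => hv0 (h.mp h3.symm)
  have hQ0 : ∀ i, Q i ≠ 0 := by
    intro i hi
    obtain ⟨s, hs, hsv⟩ : ∃ s : ℝ, s * s = v ⬝ᵥ v ∧ s ≠ v i := by
      have h1 := Real.mul_self_sqrt hvv.le
      have h2 : 0 < Real.sqrt (v ⬝ᵥ v) := Real.sqrt_pos.mpr hvv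
      by_cases h : Real.sqrt (v ⬝ᵥ v) = v i
      · exact ⟨-Real.sqrt (v ⬝ᵥ v), by rw [neg_mul_neg, h1], by rw [← h]; linarith⟩
      · exact ⟨_, h1, h⟩
    have h3 := hQ (s • Pi.single i 1 - v) i
    have h4 : u (s • Pi.single i 1 - v) i = (2 * (s - v i)) • v := by
      have h5 : (s • Pi.single i 1 - v) ⬝ᵥ (s • Pi.single i 1 - v) = 2 * s * (s - v i) := by
        simp only [sub_dotProduct, dotProduct_sub, smul_dotProduct, dotProduct_smul,
          single_dotProduct, dotProduct_single, smul_eq_mul, ← hs]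
        simp
        ring
      funext m
      simp only [u, h5]
      simp
      ring
    rw [h4, hi, map_zero, hsmul] at h3
    have h6 : (2 * (s - v i)) ^ k ≠ 0 :=
      pow_ne_zero _ (mul_ne_zero two_ne_zero (sub_ne_zero.mpr hsv))
    exact mul_ne_zero h6 hv h3.symm
  have hprod : (∏ i, Q i) ≠ 0 := Finset.prod_ne_zero_iff.mpr fun i _ => hQ0 i
  obtain ⟨w, hw⟩ : ∃ w, MvPolynomial.eval w (∏ i, Q i) ≠ 0 := by
    by_contra h
    push Not at h
    exact hprod (MvPolynomial.funext fun x => by rw [h x, map_zero])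
  have hw' : ∀ i, M (fun _ => u w i) ≠ 0 := by
    intro i
    rw [map_prod] at hw
    rw [← hQ]
    exact Finset.prod_ne_zero_iff.mp hw i (Finset.mem_univ _)
  by_cases hww : w ⬝ᵥ w = 0
  · have hd : IsEmpty (Fin d) := by
      constructor
      intro i
      apply hw' i
      have : w = 0 := dotProduct_self_eq_zero.mp hww
      exact M.map_coord_zero ⟨0, hk⟩ (by simp [u, this])
    exact ⟨1, one_mem _, fun i => hd.elim i⟩
  · refine ⟨1 - (2 / (w ⬝ᵥ w)) • Matrix.vecMulVec w w, ?_, ?_⟩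
    · rw [Matrix.mem_orthogonalGroup_iff]
      have h1 : Matrix.vecMulVec w w * Matrix.vecMulVec w w
          = (w ⬝ᵥ w) • Matrix.vecMulVec w w := by
        ext a b
        simp only [Matrix.mul_apply, Matrix.vecMulVec_apply, Matrix.smul_apply, dotProduct,
          Finset.sum_mul, smul_eq_mul]
        exact Finset.sum_congr rfl fun c _ => by ring
      have h2 : (Matrix.vecMulVec w w).transpose = Matrix.vecMulVec w w := by
        ext a b
        simp [Matrix.vecMulVec_apply, mul_comm]
      rw [Matrix.transpose_sub, Matrix.transpose_smul, h2, Matrix.transpose_one]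
      simp only [sub_mul, mul_sub, one_mul, mul_one, Matrix.smul_mul, Matrix.mul_smul, h1,
        smul_smul]
      have h3 : 2 / w ⬝ᵥ w * (2 / w ⬝ᵥ w * w ⬝ᵥ w) = 2 / w ⬝ᵥ w + 2 / w ⬝ᵥ w := by
        field_simp; norm_num
      rw [h3, add_smul]
      abel
    · intro i
      have h1 : (1 - (2 / (w ⬝ᵥ w)) • Matrix.vecMulVec w w).mulVec (Pi.single i 1)
          = (w ⬝ᵥ w)⁻¹ • u w i := by
        funext m
        simp only [u, Matrix.mulVec_single_one, Matrix.col_apply, Matrix.sub_apply,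
          Matrix.smul_apply, Matrix.vecMulVec_apply, Pi.smul_apply, Pi.sub_apply, smul_eq_mul,
          Matrix.one_apply, Pi.single_apply]
        field_simp
      rw [h1, hsmul]
      exact mul_ne_zero (pow_ne_zero _ (inv_ne_zero hww)) (hw' i)

/-- **The rotation claim** (Claim in the proof of Theorem 3.4). -/
theorem rotation_claim
    {d n l : ℕ} (hd : 0 < d) (hn : 0 < n)
    (U : Set (Fin d → ℝ)) (hU : IsOpen U) (x₀ : Fin d → ℝ) (hx₀ : x₀ ∈ U)
    (f : (Fin d → ℝ) → Fin n → ℝ)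
    (hnd : IsLNondegenerateAt l f x₀) :
    ∃ C₁ : ℝ, 0 < C₁ ∧
      ∀ a : Fin n → ℝ, ‖a‖ = 1 →
        ∃ k : ℕ, 1 ≤ k ∧ k ≤ l ∧
        ∃ O : Matrix (Fin d) (Fin d) ℝ, O ∈ Matrix.orthogonalGroup (Fin d) ℝ ∧
          ∀ i : Fin d,
            C₁ ≤ |iteratedDeriv k
              (fun t : ℝ => ∑ j, f (x₀ + t • O.mulVec (Pi.single i 1)) j * a j) 0| := by
  obtain ⟨⟨V, hV, hfV⟩, hspan⟩ := hnd
  have hf : ContDiffAt ℝ (l : ℕ) f x₀ := hfV.contDiffAt hV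
  let La : (Fin n → ℝ) → ((Fin n → ℝ) →L[ℝ] ℝ) := fun a =>
    ∑ j, a j • ContinuousLinearMap.proj (R := ℝ) (φ := fun _ : Fin n => ℝ) j
  have hLa : ∀ a y, La a y = ∑ j, y j * a j := by
    intro a y
    simp [La, mul_comm]
  -- formula for the directional derivatives
  have hform : ∀ (a : Fin n → ℝ) (k : ℕ), k ≤ l → ∀ v : Fin d → ℝ,
      iteratedDeriv k (fun t : ℝ => ∑ j, f (x₀ + t • v) j * a j) 0 =
        ∑ j, iteratedFDeriv ℝ k f x₀ (fun _ => v) j * a j := by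
    intro a k hk v
    have hfk : ContDiffAt ℝ (k : ℕ) f x₀ := hf.of_le (by exact_mod_cast hk)
    have hg : ContDiffAt ℝ (k : ℕ) (La a ∘ f) (x₀ + (0 : ℝ) • v) := by
      rw [zero_smul, add_zero]
      exact (La a).contDiff.contDiffAt.comp x₀ hfk
    have h1 := rc_line (La a ∘ f) x₀ v k 0 hg
    rw [zero_smul, add_zero, (La a).iteratedFDeriv_comp_left hfk le_rfl] at h1
    simp only [Function.comp, hLa, ContinuousLinearMap.compContinuousMultilinearMap_coe] at h1
    exact h1
  let P : (Fin n → ℝ) → ℝ → Prop := fun a C => ∃ k : ℕ, 1 ≤ k ∧ k ≤ l ∧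
        ∃ O : Matrix (Fin d) (Fin d) ℝ, O ∈ Matrix.orthogonalGroup (Fin d) ℝ ∧
          ∀ i : Fin d,
            C ≤ |iteratedDeriv k
              (fun t : ℝ => ∑ j, f (x₀ + t • O.mulVec (Pi.single i 1)) j * a j) 0|
  have hPmono : ∀ a C C', C' ≤ C → P a C → P a C' := by
    rintro a C C' h ⟨k, h1, h2, O, hO, h3⟩
    exact ⟨k, h1, h2, O, hO, fun i => h.trans (h3 i)⟩
  suffices H : ∃ C : ℝ, 0 < C ∧ ∀ a ∈ Metric.sphere (0 : Fin n → ℝ) 1, P a C by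
    obtain ⟨C, hC, h⟩ := H
    exact ⟨C, hC, fun a ha => h a (by simpa using ha)⟩
  refine (isCompact_sphere (0 : Fin n → ℝ) 1).induction_on
    (p := fun s => ∃ C : ℝ, 0 < C ∧ ∀ a ∈ s, P a C) ?_ ?_ ?_ ?_
  · exact ⟨1, one_pos, fun a ha => absurd ha (Set.notMem_empty a)⟩
  · rintro s t hst ⟨C, hC, h⟩
    exact ⟨C, hC, fun a ha => h a (hst ha)⟩
  · rintro s t ⟨C, hC, h⟩ ⟨C', hC', h'⟩
    refine ⟨min C C', lt_min hC hC', ?_⟩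
    rintro a (ha | ha)
    · exact hPmono a C _ (min_le_left _ _) (h a ha)
    · exact hPmono a C' _ (min_le_right _ _) (h' a ha)
  intro a ha
  have ha0 : a ≠ 0 := by
    rintro rfl
    simp at ha
  -- some diagonal derivative is nonzero
  obtain ⟨k, hk1, hkl, v, hv⟩ : ∃ k, 1 ≤ k ∧ k ≤ l ∧ ∃ v : Fin d → ℝ,
      La a (iteratedFDeriv ℝ k f x₀ (fun _ => v)) ≠ 0 := by
    by_contra hcon
    push Not at hcon
    apply ha0
    have hle : (⊤ : Submodule ℝ (Fin n → ℝ)) ≤ LinearMap.ker (La a).toLinearMap := by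
      rw [← hspan, Submodule.span_le]
      rintro w ⟨β, hβ1, hβl, rfl⟩
      have hfk : ContDiffAt ℝ (β.length : ℕ) f x₀ := hf.of_le (by exact_mod_cast hβl)
      rw [rc_list f β x₀ hfk]
      exact rc_polar
        ((La a).compContinuousMultilinearMap (iteratedFDeriv ℝ β.length f x₀)).toMultilinearMap
        (fun m σ => congrArg (La a) (rc_perm_symm f β.length x₀ hfk σ m))
        (fun v => hcon β.length hβ1 hβl v) _
    have h1 : La a a = 0 := hle (Submodule.mem_top (x := a))
    rw [hLa] at h1
    exact dotProduct_self_eq_zero.mp h1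
  obtain ⟨O, hO, hOi⟩ := rc_orth hk1
    ((La a).compContinuousMultilinearMap (iteratedFDeriv ℝ k f x₀)).toMultilinearMap v hv
  let G : Fin d → (Fin n → ℝ) → ℝ := fun i b =>
    |∑ j, iteratedFDeriv ℝ k f x₀ (fun _ => O.mulVec (Pi.single i 1)) j * b j|
  have hGc : ∀ i, Continuous (G i) := by
    intro i
    simp only [G]
    fun_prop
  have hGa : ∀ i, 0 < G i a := by
    intro i
    have h := hOi i
    change La a (iteratedFDeriv ℝ k f x₀ (fun _ => O.mulVec (Pi.single i 1))) ≠ 0 at h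
    rw [hLa] at h
    exact abs_pos.mpr h
  have : Nonempty (Fin d) := ⟨⟨0, hd⟩⟩
  obtain ⟨i₀, hi₀⟩ := Finite.exists_min (fun i => G i a)
  refine ⟨{b | ∀ i, G i a / 2 < G i b}, ?_, G i₀ a / 2, half_pos (hGa i₀), ?_⟩
  · apply mem_nhdsWithin_of_mem_nhds
    apply Filter.eventually_all.mpr
    intro i
    exact (hGc i).continuousAt.eventually (lt_mem_nhds (half_lt_self (hGa i)))
  · intro b hb
    refine ⟨k, hk1, hkl, O, hO, fun i => ?_⟩
    rw [hform b k hkl]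
    have h1 := hb i
    have h2 := hi₀ i
    simp only [G] at h1 h2 ⊢
    linarith
end

section
/- Let f:U→ℝ^n be of the Monge form on an open set U⊂ℝ^d with n=d+m, θ∈ℝ^n, and suppose f is nondegenerate at x_0∈U. Let V, C_0, K_0, B⊂V, t_0, t≥t_0 and ε∈(0,1) with ε > K_0 e^{−ηt} be as in the divergence measure theorem (so that L_d(Δ_θ(t,ε,B,ρ)) ≥ (1/2)L_d(B) with ρ = (C_0/(ε^m e^{(d+1)t}))^{1/d}). Then #𝒩_θ(t,ε,B) ≥ ε^m e^{(d+1)t} L_d(B)/(2 V_d C_0), where V_d is the Lebesgue measure of the unit sup-norm ball in ℝ^d. -/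
open MeasureTheory Filter Set
open scoped ENNReal NNReal

theorem finite_int_box {k : ℕ} (a b : Fin k → ℝ) :
    {p : Fin k → ℤ | ∀ j, a j ≤ (p j : ℝ) ∧ (p j : ℝ) ≤ b j}.Finite := by
  refine (Set.finite_Icc (fun j => ⌈a j⌉) (fun j => ⌊b j⌋)).subset ?_
  intro p hp
  exact ⟨fun j => Int.ceil_le.2 (hp j).1, fun j => Int.le_floor.2 (hp j).2⟩

theorem NCal_finite {d m : ℕ} (f : (Fin d → ℝ) → Fin m → ℝ) (θ : Fin (d + m) → ℝ)
    (t : ℕ) (ε : ℝ) (z : Fin d → ℝ) (r : ℝ) :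
    (NCal f θ t ε (Metric.ball z r)).Finite := by
  have hQ : (Set.Iic ⌊Real.exp t⌋₊).Finite := Set.finite_Iic _
  let P : ℕ → Set (Fin d → ℤ) := fun q => {p | ∀ j,
    (q : ℝ) * (z j - r) - θ (Fin.castAdd m j) ≤ (p j : ℝ) ∧
    (p j : ℝ) ≤ (q : ℝ) * (z j + r) - θ (Fin.castAdd m j)}
  let c : ℕ → (Fin d → ℤ) → Fin m → ℝ := fun q p j =>
    (q : ℝ) * f (fun i => ((p i : ℝ) + θ (Fin.castAdd m i)) / (q : ℝ)) j - θ (Fin.natAdd d j)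
  let R : ℕ → (Fin d → ℤ) → Set (Fin m → ℤ) := fun q p => {s | ∀ j,
    c q p j - ε ≤ (s j : ℝ) ∧ (s j : ℝ) ≤ c q p j + ε}
  have hfin : (⋃ q ∈ Set.Iic ⌊Real.exp t⌋₊, ⋃ p ∈ P q,
      (fun s => (q, p, s)) '' R q p).Finite :=
    hQ.biUnion fun q _ => (finite_int_box _ _).biUnion fun p _ => (finite_int_box _ _).image _
  refine hfin.subset ?_
  rintro ⟨q, p, s⟩ ⟨hq, hb, -, hqt, hs⟩
  simp only at hq hb hqt hs
  have hq' : (0 : ℝ) < q := by exact_mod_cast hq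
  simp only [Set.mem_iUnion]
  refine ⟨q, Nat.le_floor hqt, p, ?_, s, ?_, rfl⟩
  · intro j
    have h := (dist_le_pi_dist _ z j).trans_lt (Metric.mem_ball.1 hb)
    rw [Real.dist_eq, abs_lt] at h
    have h1 : z j - r ≤ ((p j : ℝ) + θ (Fin.castAdd m j)) / q := by linarith [h.1]
    have h2 : ((p j : ℝ) + θ (Fin.castAdd m j)) / q ≤ z j + r := by linarith [h.2]
    rw [le_div_iff₀ hq'] at h1
    rw [div_le_iff₀ hq'] at h2
    constructor <;> linarith
  · intro j
    have h := (norm_le_pi_norm _ j).trans hs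
    rw [Real.norm_eq_abs, abs_le] at h
    constructor
    · simp only [c]; linarith [h.2]
    · simp only [c]; linarith [h.1]

/-- **Counting lower bound from the measure bound** (Corollary 5.4). -/
theorem counting_lower_bound_from_measure
    {d m : ℕ} (hd : 0 < d) (hm : 0 < m)
    (U : Set (Fin d → ℝ)) (hU : IsOpen U)
    (f : (Fin d → ℝ) → Fin m → ℝ) (θ : Fin (d + m) → ℝ)
    (x₀ : Fin d → ℝ) (hx₀ : x₀ ∈ U)
    (hnd : IsNondegenerateAt (fullMap d m f) x₀)
    (C₀ K₀ : ℝ) (hC₀ : 0 < C₀) (hK₀ : 0 < K₀)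
    (z : Fin d → ℝ) (r : ℝ) (hr : 0 < r) (hBU : Metric.ball z r ⊆ U)
    (t : ℕ) (ε : ℝ) (hε0 : 0 < ε) (hε1 : ε < 1)
    (hεt : K₀ * Real.exp (-(etaND (d + m) d) * t) < ε)
    (hmeas : ENNReal.ofReal ((1 : ℝ) / 2) * volume (Metric.ball z r) ≤
      volume (DeltaCal f θ t ε (Metric.ball z r)
        ((C₀ / (ε ^ m * Real.exp (((d : ℝ) + 1) * t))) ^ ((1 : ℝ) / d)))) :
    ε ^ m * Real.exp (((d : ℝ) + 1) * t) * (volume (Metric.ball z r)).toReal /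
        (2 * (volume (Metric.ball (0 : Fin d → ℝ) 1)).toReal * C₀) ≤
      ((NCal f θ t ε (Metric.ball z r)).ncard : ℝ) := by
  have hfin := NCal_finite f θ t ε z r
  set N := NCal f θ t ε (Metric.ball z r) with hN
  set A := ε ^ m * Real.exp (((d : ℝ) + 1) * t) with hA
  have hApos : 0 < A := by positivity
  set ρ := (C₀ / A) ^ ((1 : ℝ) / d) with hρ
  have hρpos : 0 < ρ := by positivity
  have hρd : ρ ^ d = C₀ / A := by
    rw [hρ, one_div]
    exact Real.rpow_inv_natCast_pow (by positivity) hd.ne'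
  set W := volume (Metric.ball (0 : Fin d → ℝ) 1) with hW
  have hWtop : W ≠ ⊤ := measure_ball_lt_top.ne
  have hWpos : 0 < W.toReal :=
    ENNReal.toReal_pos (Metric.measure_ball_pos _ _ one_pos).ne' hWtop
  have hle : volume (DeltaCal f θ t ε (Metric.ball z r) ρ) ≤
      (N.ncard : ℝ≥0∞) * (ENNReal.ofReal (C₀ / A) * W) := by
    have hD : DeltaCal f θ t ε (Metric.ball z r) ρ = ⋃ q ∈ hfin.toFinset,
        Metric.ball (fun i => ((q.2.1 i : ℝ) + θ (Fin.castAdd m i)) / (q.1 : ℝ)) ρ := by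
      simp [DeltaCal, hN]
    rw [hD]
    refine (measure_biUnion_finset_le _ _).trans ?_
    have : ∀ q ∈ hfin.toFinset, volume (Metric.ball
        (fun i => ((q.2.1 i : ℝ) + θ (Fin.castAdd m i)) / (q.1 : ℝ)) ρ)
        = ENNReal.ofReal (C₀ / A) * W := by
      intro q _
      rw [Measure.addHaar_ball_of_pos _ _ hρpos]
      simp [hρd, hW]
    rw [Finset.sum_congr rfl this, Finset.sum_const, nsmul_eq_mul,
      Set.ncard_eq_toFinset_card N hfin]
  have h := hmeas.trans hle
  have h2 := ENNReal.toReal_mono (by finiteness) h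
  rw [ENNReal.toReal_mul, ENNReal.toReal_mul, ENNReal.toReal_mul, ENNReal.toReal_natCast,
    ENNReal.toReal_ofReal (by norm_num), ENNReal.toReal_ofReal (by positivity)] at h2
  rw [div_le_iff₀ (by positivity)]
  have h3 := mul_le_mul_of_nonneg_left h2 (by positivity : 0 ≤ 2 * A)
  have h4 : 2 * A * ((N.ncard : ℝ) * (C₀ / A * W.toReal)) =
      (N.ncard : ℝ) * (2 * W.toReal * C₀) := by
    field_simp
  rw [h4] at h3
  linarith
end
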